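/- arXiv:2108.08655 — 3 statements merged into one kernel-verified Lean document; each statement's English description precedes it below -/
import Mathlib

section
/- The critic fluctuation processes vanish uniformly in time: for any state-action pair ξ = (x,a) and any T > 0, each of M_t^{1,N}(ξ), M_t^{2,N}(ξ), M_t^{3,N}(ξ) converges to 0 in L¹ uniformly over t ∈ (0,T] as N → ∞, where M_t^{1,N}(ξ) = −(1/N) Σ_{k<⌊Nt⌋} Q_k(ξ_k) 1_{{ξ_k=ξ}} + (1/N) Σ_{k<⌊Nt⌋} Σ_{ξ'} Q_k(ξ') 1_{{ξ'=ξ}} π^{g_{θ_k}}(ξ'), M_t^{2,N}(ξ) = (1/N) Σ_{k<⌊Nt⌋} r(ξ_k) 1_{{ξ_k=ξ}} − (1/N) Σ_{k<⌊Nt⌋} Σ_{ξ'} r(ξ') 1_{{ξ'=ξ}} π^{g_{θ_k}}(ξ'), and M_t^{3,N}(ξ) = (1/N) Σ_{k<⌊Nt⌋} γ Σ_{a''} Q_k(x_{k+1},a'') g_{θ_k}(x_{k+1},a'') 1_{{ξ_k=ξ}} − (1/N) Σ_{k<⌊Nt⌋} Σ_{ξ'} Σ_{z,a''} γ Q_k(z,a'')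 g_{θ_k}(z,a'') 1_{{ξ'=ξ}} π^{g_{θ_k}}(ξ') p(z|ξ'). -/
open MeasureTheory Filter Set
open scoped Classical

noncomputable section

def softmaxPol {X A : Type*} [Fintype A] (θ : X → A → ℝ) (x : X) (a : A) : ℝ :=
  Real.exp (θ x a) / ∑ a', Real.exp (θ x a')

def explorePol {X A : Type*} [Fintype A] (η : ℝ) (θ : X → A → ℝ) (x : X) (a : A) : ℝ :=
  η / (Fintype.card A : ℝ) + (1 - η) * softmaxPol θ x a

def zetaN (N k : ℕ) : ℝ := (1 + (k : ℝ) / (N : ℝ))⁻¹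

def etaN (N k : ℕ) : ℝ := (1 + (Real.log ((k : ℝ) / (N : ℝ) + 1)) ^ 2)⁻¹

def zetaT (t : ℝ) : ℝ := (1 + t)⁻¹

def etaT (t : ℝ) : ℝ := (1 + (Real.log (t + 1)) ^ 2)⁻¹

def IsPolicy {X A : Type*} [Fintype A] (f : X → A → ℝ) : Prop :=
  (∀ x a, 0 ≤ f x a) ∧ ∀ x, ∑ a, f x a = 1

def ptilde {X A : Type*} (γ : ℝ) (p : X → A → X → ℝ) (μ : X → ℝ)
    (x : X) (a : A) (x' : X) : ℝ :=
  γ * p x a x' + (1 - γ) * μ x'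

def actorKer {X A : Type*} (γ : ℝ) (p : X → A → X → ℝ) (μ : X → ℝ) (f : X → A → ℝ) :
    X × A → X × A → ℝ :=
  fun ξ ξ' => ptilde γ p μ ξ.1 ξ.2 ξ'.1 * f ξ'.1 ξ'.2

def criticKer {X A : Type*} (p : X → A → X → ℝ) (g : X → A → ℝ) :
    X × A → X × A → ℝ :=
  fun ξ ξ' => p ξ.1 ξ.2 ξ'.1 * g ξ'.1 ξ'.2

def kpow {S : Type*} [Fintype S] [DecidableEq S] (K : S → S → ℝ) : ℕ → S → S → ℝ
  | 0 => fun ξ ξ' => if ξ = ξ' then 1 else 0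
  | n + 1 => fun ξ ξ' => ∑ y, K ξ y * kpow K n y ξ'

def IsStationaryDist {S : Type*} [Fintype S] (K : S → S → ℝ) (d : S → ℝ) : Prop :=
  (∀ ξ, 0 ≤ d ξ) ∧ (∑ ξ, d ξ = 1) ∧ ∀ ξ', d ξ' = ∑ ξ, d ξ * K ξ ξ'

def pathSum {X A : Type*} [Fintype X] [Fintype A] [DecidableEq X]
    (p : X → A → X → ℝ) : ℕ → X → A → X → ℝ
  | 0 => fun x _ x' => if x = x' then 1 else 0
  | 1 => fun x a x' => p x a x'
  | n + 2 => fun x a x' => ∑ x₁ : X, ∑ a₁ : A, p x a x₁ * pathSum p (n + 1) x₁ a₁ x'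

/-- A row-stochastic matrix on a finite set. -/
structure IsStochastic {S : Type*} [Fintype S] (K : S → S → ℝ) : Prop where
  nonneg : ∀ s s', 0 ≤ K s s'
  row_sum : ∀ s, ∑ s', K s s' = 1

/-- The action of a kernel on functions. -/
def kernelApp {S : Type*} [Fintype S] (K : S → S → ℝ) (f : S → ℝ) (s : S) : ℝ :=
  ∑ s', K s s' * f s'

section Kernel

variable {S : Type*} [Fintype S]

lemma IsStochastic.abs_kernelApp_le {K : S → S → ℝ} (hK : IsStochastic K) {f : S → ℝ} {C : ℝ}
    (hf : ∀ s, |f s| ≤ C) (s : S) : |kernelApp K f s| ≤ C := by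
  calc |kernelApp K f s| ≤ ∑ s', |K s s' * f s'| := Finset.abs_sum_le_sum_abs _ _
    _ ≤ ∑ s', K s s' * C := by
        refine Finset.sum_le_sum fun s' _ => ?_
        rw [abs_mul, abs_of_nonneg (hK.nonneg s s')]
        exact mul_le_mul_of_nonneg_left (hf s') (hK.nonneg s s')
    _ = C := by rw [← Finset.sum_mul, hK.row_sum, one_mul]

lemma IsStochastic.abs_iterate_le {K : S → S → ℝ} (hK : IsStochastic K) {f : S → ℝ} {C : ℝ}
    (hf : ∀ s, |f s| ≤ C) (j : ℕ) (s : S) : |(kernelApp K)^[j] f s| ≤ C := by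
  induction j generalizing s with
  | zero => exact hf s
  | succ j ih =>
    rw [Function.iterate_succ_apply']
    exact hK.abs_kernelApp_le ih s

lemma abs_kernelApp_sub_le {K K' : S → S → ℝ} {f : S → ℝ} {C e : ℝ}
    (hf : ∀ s, |f s| ≤ C) (he : ∀ s, ∑ s', |K s s' - K' s s'| ≤ e) (hC : 0 ≤ C) (s : S) :
    |kernelApp K f s - kernelApp K' f s| ≤ e * C := by
  calc |kernelApp K f s - kernelApp K' f s| = |∑ s', (K s s' - K' s s') * f s'| := by
        simp only [kernelApp, sub_mul, Finset.sum_sub_distrib]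
    _ ≤ ∑ s', |(K s s' - K' s s') * f s'| := Finset.abs_sum_le_sum_abs _ _
    _ ≤ ∑ s', |K s s' - K' s s'| * C := by
        refine Finset.sum_le_sum fun s' _ => ?_
        rw [abs_mul]
        exact mul_le_mul_of_nonneg_left (hf s') (abs_nonneg _)
    _ ≤ e * C := by
        rw [← Finset.sum_mul]
        exact mul_le_mul_of_nonneg_right (he s) hC

lemma kernelApp_sub (K : S → S → ℝ) (f f' : S → ℝ) (s : S) :
    kernelApp K f s - kernelApp K f' s = kernelApp K (fun s => f s - f' s) s := by
  simp only [kernelApp, mul_sub, Finset.sum_sub_distrib]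

lemma kernelApp_add (K : S → S → ℝ) (f f' : S → ℝ) (s : S) :
    kernelApp K (fun s => f s + f' s) s = kernelApp K f s + kernelApp K f' s := by
  simp only [kernelApp, mul_add, Finset.sum_add_distrib]

lemma abs_iterate_sub_le {K K' : S → S → ℝ} (hK : IsStochastic K) (hK' : IsStochastic K')
    {f f' : S → ℝ} {C d e : ℝ} (hC : 0 ≤ C) (hf' : ∀ s, |f' s| ≤ C)
    (hd : ∀ s, |f s - f' s| ≤ d) (he : ∀ s, ∑ s', |K s s' - K' s s'| ≤ e) (j : ℕ) (s : S) :
    |(kernelApp K)^[j] f s - (kernelApp K')^[j] f' s| ≤ d + j * (e * C) := by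
  induction j generalizing s with
  | zero => simpa using hd s
  | succ j ih =>
    simp only [Function.iterate_succ_apply']
    have h1 := hK.abs_kernelApp_le ih s
    rw [← kernelApp_sub] at h1
    have h2 := abs_kernelApp_sub_le (hK'.abs_iterate_le hf' j) he hC s
    have h3 := abs_sub_le (kernelApp K ((kernelApp K)^[j] f) s)
      (kernelApp K ((kernelApp K')^[j] f') s) (kernelApp K' ((kernelApp K')^[j] f') s)
    push_cast
    linarith

lemma IsStochastic.kpow [DecidableEq S] {K : S → S → ℝ} (hK : IsStochastic K) (n : ℕ) :
    IsStochastic (kpow K n) := by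
  induction n with
  | zero =>
    refine ⟨fun s s' => ?_, fun s => ?_⟩
    · simp only [_root_.kpow]; split_ifs <;> norm_num
    · simp [_root_.kpow]
  | succ n ih =>
    refine ⟨fun s s' => Finset.sum_nonneg fun y _ => mul_nonneg (hK.nonneg _ _) (ih.nonneg _ _),
      fun s => ?_⟩
    simp only [_root_.kpow]
    rw [Finset.sum_comm]
    simp only [← Finset.mul_sum, ih.row_sum, mul_one, hK.row_sum]

lemma kernelApp_kpow [DecidableEq S] (K : S → S → ℝ) (n : ℕ) (f : S → ℝ) (s : S) :
    kernelApp (kpow K n) f s = (kernelApp K)^[n] f s := by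
  induction n generalizing s with
  | zero => simp [kernelApp, kpow]
  | succ n ih =>
    rw [Function.iterate_succ_apply']
    simp only [kernelApp, kpow] at ih ⊢
    simp only [← ih, Finset.sum_mul, Finset.mul_sum, mul_assoc]
    exact Finset.sum_comm

lemma pow_mul_kpow_le [DecidableEq S] {K K' : S → S → ℝ} {δ : ℝ} (hδ : 0 ≤ δ)
    (hK' : IsStochastic K') (h : ∀ s s', δ * K' s s' ≤ K s s') (n : ℕ) (s s' : S) :
    δ ^ n * kpow K' n s s' ≤ kpow K n s s' := by
  induction n generalizing s with
  | zero => simp [kpow]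
  | succ n ih =>
    simp only [kpow, Finset.mul_sum]
    refine Finset.sum_le_sum fun y _ => ?_
    calc δ ^ (n + 1) * (K' s y * kpow K' n y s')
        = (δ * K' s y) * (δ ^ n * kpow K' n y s') := by ring
      _ ≤ K s y * kpow K n y s' := by
        have h0 : 0 ≤ δ * K' s y := mul_nonneg hδ (hK'.nonneg _ _)
        refine mul_le_mul (h s y) (ih y) ?_ (h0.trans (h s y))
        exact mul_nonneg (pow_nonneg hδ n) ((hK'.kpow n).nonneg _ _)

/-- A stochastic matrix with entries at least `β` contracts oscillations by the factor `1 - β`. -/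
lemma IsStochastic.exists_range_kernelApp [Nonempty S] {W : S → S → ℝ} (hW : IsStochastic W)
    {β : ℝ} (hβ : ∀ s s', β ≤ W s s') {f : S → ℝ} {lo d : ℝ}
    (hf : ∀ s, lo ≤ f s ∧ f s ≤ lo + d) :
    ∃ lo', ∀ s, lo' ≤ kernelApp W f s ∧ kernelApp W f s ≤ lo' + (1 - β) * d := by
  classical
  obtain ⟨s₀⟩ := ‹Nonempty S›
  set w : S → S → ℝ := fun s s' => W s s' - if s' = s₀ then β else 0 with hw
  have hw0 : ∀ s s', 0 ≤ w s s' := by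
    intro s s'
    simp only [hw]
    split_ifs
    · exact sub_nonneg.2 (hβ _ _)
    · simpa using hW.nonneg s s'
  have hws : ∀ s, ∑ s', w s s' = 1 - β := by
    intro s; simp [hw, Finset.sum_sub_distrib, hW.row_sum]
  have happ : ∀ s, kernelApp W f s = β * f s₀ + ∑ s', w s s' * f s' := by
    intro s; simp [hw, kernelApp, sub_mul, Finset.sum_sub_distrib]
  refine ⟨β * f s₀ + (1 - β) * lo, fun s => ?_⟩
  have h1 : (1 - β) * lo ≤ ∑ s', w s s' * f s' := by
    rw [← hws s, Finset.sum_mul]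
    exact Finset.sum_le_sum fun s' _ => mul_le_mul_of_nonneg_left (hf s').1 (hw0 s s')
  have h2 : ∑ s', w s s' * f s' ≤ (1 - β) * (lo + d) := by
    rw [← hws s, Finset.sum_mul]
    exact Finset.sum_le_sum fun s' _ => mul_le_mul_of_nonneg_left (hf s').2 (hw0 s s')
  rw [happ]
  constructor <;> linarith

lemma IsStationaryDist.sum_mul_kernelApp {K : S → S → ℝ} {d : S → ℝ} (hd : IsStationaryDist K d)
    (f : S → ℝ) : ∑ s, d s * kernelApp K f s = ∑ s, d s * f s := by
  have h : ∀ s', d s' * f s' = ∑ s, d s * (K s s' * f s') := by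
    intro s'
    conv_lhs => rw [hd.2.2 s', Finset.sum_mul]
    exact Finset.sum_congr rfl fun s _ => by ring
  simp only [h, kernelApp, Finset.mul_sum]
  exact Finset.sum_comm

lemma IsStationaryDist.sum_mul_iterate {K : S → S → ℝ} {d : S → ℝ} (hd : IsStationaryDist K d)
    (f : S → ℝ) (j : ℕ) : ∑ s, d s * (kernelApp K)^[j] f s = ∑ s, d s * f s := by
  induction j with
  | zero => rfl
  | succ j ih => rw [Function.iterate_succ_apply', hd.sum_mul_kernelApp, ih]

/-- Geometric ergodicity under a Doeblin minorization of the `n`-step kernel. -/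
lemma IsStationaryDist.abs_iterate_sub_le [Nonempty S] [DecidableEq S] {K : S → S → ℝ}
    (hK : IsStochastic K) {d : S → ℝ} (hd : IsStationaryDist K d) {n : ℕ} {β : ℝ}
    (hβ : ∀ s s', β ≤ _root_.kpow K n s s') {f : S → ℝ} {C : ℝ} (hf : ∀ s, |f s| ≤ C)
    (m : ℕ) (s : S) :
    |(kernelApp K)^[n * m] f s - ∑ s', d s' * f s'| ≤ (1 - β) ^ m * (2 * C) := by
  have key : ∃ lo, ∀ s, lo ≤ (kernelApp K)^[n * m] f s ∧
      (kernelApp K)^[n * m] f s ≤ lo + (1 - β) ^ m * (2 * C) := by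
    induction m with
    | zero =>
      refine ⟨-C, fun s => ?_⟩
      have := abs_le.1 (hf s)
      simp only [Nat.mul_zero, Function.iterate_zero, id, pow_zero]
      constructor <;> linarith [this.1, this.2]
    | succ m ih =>
      obtain ⟨lo, hlo⟩ := ih
      obtain ⟨lo', hlo'⟩ := (hK.kpow n).exists_range_kernelApp hβ hlo
      refine ⟨lo', fun s => ?_⟩
      have h := hlo' s
      rw [kernelApp_kpow, ← Function.iterate_add_apply] at h
      rw [Nat.mul_succ, Nat.add_comm, pow_succ', mul_assoc]
      exact h
  obtain ⟨lo, hlo⟩ := key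
  have h1 : lo ≤ ∑ s', d s' * f s' := by
    rw [← hd.sum_mul_iterate f (n * m)]
    calc lo = ∑ s', d s' * lo := by rw [← Finset.sum_mul, hd.2.1, one_mul]
      _ ≤ _ := Finset.sum_le_sum fun s' _ => mul_le_mul_of_nonneg_left (hlo s').1 (hd.1 s')
  have h2 : ∑ s', d s' * f s' ≤ lo + (1 - β) ^ m * (2 * C) := by
    rw [← hd.sum_mul_iterate f (n * m)]
    calc _ ≤ ∑ s', d s' * (lo + (1 - β) ^ m * (2 * C)) :=
          Finset.sum_le_sum fun s' _ => mul_le_mul_of_nonneg_left (hlo s').2 (hd.1 s')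
      _ = _ := by rw [← Finset.sum_mul, hd.2.1, one_mul]
  rw [abs_le]
  constructor <;> linarith [(hlo s).1, (hlo s).2]

/-- The truncated solution `∑ j < L, K^j f` of the Poisson equation. -/
def truncPoisson (K : S → S → ℝ) (f : S → ℝ) (L : ℕ) (s : S) : ℝ :=
  ∑ j ∈ Finset.range L, (kernelApp K)^[j] f s

lemma truncPoisson_sub_kernelApp (K : S → S → ℝ) (f : S → ℝ) (L : ℕ) (s : S) :
    truncPoisson K f L s - kernelApp K (truncPoisson K f L) s
      = f s - (kernelApp K)^[L] f s := by
  have h : kernelApp K (truncPoisson K f L) s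
      = ∑ j ∈ Finset.range L, (kernelApp K)^[j + 1] f s := by
    simp only [Function.iterate_succ_apply']
    simp only [kernelApp, truncPoisson, Finset.mul_sum]
    exact Finset.sum_comm
  rw [h, truncPoisson, ← Finset.sum_sub_distrib,
    Finset.sum_range_sub' (fun j => (kernelApp K)^[j] f s)]
  rfl

lemma IsStochastic.abs_truncPoisson_le {K : S → S → ℝ} (hK : IsStochastic K) {f : S → ℝ} {C : ℝ}
    (hf : ∀ s, |f s| ≤ C) (L : ℕ) (s : S) : |truncPoisson K f L s| ≤ L * C := by
  refine (Finset.abs_sum_le_sum_abs _ _).trans ?_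
  calc _ ≤ ∑ _j ∈ Finset.range L, C := Finset.sum_le_sum fun j _ => hK.abs_iterate_le hf j s
    _ = L * C := by simp

lemma abs_truncPoisson_sub_le {K K' : S → S → ℝ} (hK : IsStochastic K) (hK' : IsStochastic K')
    {f f' : S → ℝ} {C d e : ℝ} (hC : 0 ≤ C) (he0 : 0 ≤ e) (hf' : ∀ s, |f' s| ≤ C)
    (hd : ∀ s, |f s - f' s| ≤ d) (he : ∀ s, ∑ s', |K s s' - K' s s'| ≤ e) (L : ℕ) (s : S) :
    |truncPoisson K f L s - truncPoisson K' f' L s| ≤ L * (d + L * (e * C)) := by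
  rw [truncPoisson, truncPoisson, ← Finset.sum_sub_distrib]
  refine (Finset.abs_sum_le_sum_abs _ _).trans ?_
  calc _ ≤ ∑ _j ∈ Finset.range L, (d + L * (e * C)) := by
        refine Finset.sum_le_sum fun j hj => ?_
        refine (_root_.abs_iterate_sub_le hK hK' hC hf' hd he j s).trans ?_
        have : (j : ℝ) ≤ L := by exact_mod_cast (Finset.mem_range.1 hj).le
        have := mul_le_mul_of_nonneg_right this (mul_nonneg he0 hC)
        linarith
    _ = _ := by rw [Finset.sum_const, Finset.card_range, nsmul_eq_mul]

end Kernel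

section Martingale

lemma measurable_apply_finite {Ω S : Type*} {m : MeasurableSpace Ω} [Fintype S]
    [MeasurableSpace S] [MeasurableSingletonClass S] {f : Ω → S → ℝ} {ξ : Ω → S}
    (hf : ∀ s, Measurable fun ω => f ω s) (hξ : Measurable ξ) :
    Measurable fun ω => f ω (ξ ω) := by
  classical
  have h : (fun ω => f ω (ξ ω)) = fun ω => ∑ s, if ξ ω = s then f ω s else 0 := by
    funext ω; simp
  rw [h]
  exact Finset.measurable_sum _ fun s _ =>
    Measurable.ite (hξ (measurableSet_singleton s)) (hf s) measurable_const

lemma measurable_kernelApp {Ω S : Type*} {m : MeasurableSpace Ω} [Fintype S]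
    {K : Ω → S → S → ℝ} {f : Ω → S → ℝ} (hK : ∀ s s', Measurable fun ω => K ω s s')
    (hf : ∀ s, Measurable fun ω => f ω s) (s : S) :
    Measurable fun ω => kernelApp (K ω) (f ω) s :=
  Finset.measurable_sum _ fun s' _ => (hK s s').mul (hf s')

lemma measurable_truncPoisson {Ω S : Type*} {m : MeasurableSpace Ω} [Fintype S]
    {K : Ω → S → S → ℝ} {f : Ω → S → ℝ} (hK : ∀ s s', Measurable fun ω => K ω s s')
    (hf : ∀ s, Measurable fun ω => f ω s) (L : ℕ) (s : S) :
    Measurable fun ω => truncPoisson (K ω) (f ω) L s := by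
  refine Finset.measurable_sum _ fun j hj => ?_
  clear hj
  induction j generalizing s with
  | zero => exact hf s
  | succ j ih =>
    simp only [Function.iterate_succ_apply']
    exact measurable_kernelApp hK ih s

lemma integral_mul_sub_condExp_eq_zero {Ω : Type*} {m mΩ : MeasurableSpace Ω} {P : Measure Ω}
    [IsProbabilityMeasure P] (hm : m ≤ mΩ) {Y q Z : Ω → ℝ}
    {C : ℝ} (hZ : Measurable[m] Z) (hZC : ∀ ω, |Z ω| ≤ C) (hY : Integrable Y P)
    (hq : P[Y|m] =ᵐ[P] q) : ∫ ω, Z ω * (Y ω - q ω) ∂P = 0 := by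
  have hqi : Integrable q P := integrable_condExp.congr hq
  have hZm : AEStronglyMeasurable Z P := (hZ.mono hm le_rfl).aestronglyMeasurable
  have hZb : ∀ᵐ ω ∂P, ‖Z ω‖ ≤ C := Eventually.of_forall hZC
  have h1 : Integrable (fun ω => Z ω * Y ω) P := hY.bdd_mul hZm hZb
  have h2 : Integrable (fun ω => Z ω * q ω) P := hqi.bdd_mul hZm hZb
  have h3 : ∫ ω, Z ω * Y ω ∂P = ∫ ω, Z ω * q ω ∂P := by
    have hc : P[fun ω => Z ω * Y ω|m] =ᵐ[P] fun ω => Z ω * (P[Y|m]) ω :=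
      condExp_mul_of_stronglyMeasurable_left hZ.stronglyMeasurable h1 hY
    rw [← integral_condExp hm, integral_congr_ae hc]
    refine integral_congr_ae ?_
    filter_upwards [hq] with ω h
    rw [h]
  simp only [mul_sub]
  rw [integral_sub h1 h2, h3, sub_self]

variable {Ω S : Type*} [Fintype S] [MeasurableSpace S] [MeasurableSingletonClass S]
  {mΩ : MeasurableSpace Ω} {P : Measure Ω} [IsProbabilityMeasure P]

lemma integrable_of_measurable_bdd {f : Ω → ℝ} {C : ℝ} (hf : Measurable f)
    (hC : ∀ ω, |f ω| ≤ C) : Integrable f P :=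
  Integrable.of_bound hf.aestronglyMeasurable C (Eventually.of_forall hC)

/-- Second moment of a sum of bounded martingale increments along a controlled Markov chain whose
transition kernel from time `k` to time `k + 1` is `K (k + 1)`. -/
lemma integral_sq_sum_martingale_le [DecidableEq S] {ℱ : Filtration ℕ mΩ} {ξ : ℕ → Ω → S}
    {K : ℕ → Ω → S → S → ℝ} {V : ℕ → Ω → S → ℝ} {C : ℝ}
    (hξ : ∀ k, Measurable[ℱ k] (ξ k))
    (hK : ∀ k ω, IsStochastic (K k ω))
    (hKm : ∀ k s s', Measurable[ℱ k] fun ω => K (k + 1) ω s s')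
    (hV : ∀ k s, Measurable[ℱ k] fun ω => V k ω s)
    (hVC : ∀ k ω s, |V k ω s| ≤ C)
    (hM : ∀ k s, P[(fun ω => if ξ (k + 1) ω = s then (1 : ℝ) else 0)|ℱ k]
      =ᵐ[P] fun ω => K (k + 1) ω (ξ k ω) s) (n : ℕ) :
    Integrable (fun ω => (∑ k ∈ Finset.range n,
        (V k ω (ξ (k + 1) ω) - kernelApp (K (k + 1) ω) (V k ω) (ξ k ω))) ^ 2) P ∧
      ∫ ω, (∑ k ∈ Finset.range n,
        (V k ω (ξ (k + 1) ω) - kernelApp (K (k + 1) ω) (V k ω) (ξ k ω))) ^ 2 ∂P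
          ≤ n * (2 * C) ^ 2 := by
  set D : ℕ → Ω → ℝ := fun k ω =>
    V k ω (ξ (k + 1) ω) - kernelApp (K (k + 1) ω) (V k ω) (ξ k ω) with hD
  have hDm : ∀ k, Measurable[ℱ (k + 1)] (D k) := by
    intro k
    have hle : ℱ k ≤ ℱ (k + 1) := ℱ.mono (Nat.le_succ k)
    refine Measurable.sub ?_ ?_
    · exact measurable_apply_finite (m := ℱ (k + 1)) (fun s => (hV k s).mono hle le_rfl)
        (hξ (k + 1))
    · exact (measurable_apply_finite (m := ℱ k)
        (measurable_kernelApp (m := ℱ k) (hKm k) (hV k)) (hξ k)).mono hle le_rfl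
  have hDC : ∀ k ω, |D k ω| ≤ 2 * C := by
    intro k ω
    have h1 := hVC k ω (ξ (k + 1) ω)
    have h2 := (hK (k + 1) ω).abs_kernelApp_le (hVC k ω) (ξ k ω)
    have h3 := abs_sub (V k ω (ξ (k + 1) ω)) (kernelApp (K (k + 1) ω) (V k ω) (ξ k ω))
    simp only [hD]
    linarith
  have hDsum : ∀ k ω, D k ω = ∑ s, V k ω s *
      ((if ξ (k + 1) ω = s then (1 : ℝ) else 0) - K (k + 1) ω (ξ k ω) s) := by
    intro k ω
    simp [hD, kernelApp, mul_sub, Finset.sum_sub_distrib, mul_comm]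
  have hSm : ∀ n, Measurable[ℱ n] fun ω => ∑ k ∈ Finset.range n, D k ω := by
    intro n
    refine Finset.measurable_sum _ fun k hk => ?_
    exact (hDm k).mono (ℱ.mono (Finset.mem_range.1 hk)) le_rfl
  have hSC : ∀ n ω, |∑ k ∈ Finset.range n, D k ω| ≤ n * (2 * C) := by
    intro n ω
    refine (Finset.abs_sum_le_sum_abs _ _).trans ?_
    refine (Finset.sum_le_sum fun k _ => hDC k ω).trans (by simp)
  have hSint : ∀ n, Integrable (fun ω => (∑ k ∈ Finset.range n, D k ω) ^ 2) P := by
    intro n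
    refine integrable_of_measurable_bdd (C := (n * (2 * C)) ^ 2)
      (((hSm n).mono (ℱ.le n) le_rfl).pow_const 2) fun ω => ?_
    rw [abs_pow]
    exact pow_le_pow_left₀ (abs_nonneg _) (hSC n ω) 2
  refine ⟨hSint n, ?_⟩
  change ∫ ω, (∑ k ∈ Finset.range n, D k ω) ^ 2 ∂P ≤ n * (2 * C) ^ 2
  induction n with
  | zero => simp
  | succ n ih =>
    have hDM : Measurable (D n) := (hDm n).mono (ℱ.le (n + 1)) le_rfl
    have hSM : Measurable fun ω => ∑ k ∈ Finset.range n, D k ω := (hSm n).mono (ℱ.le n) le_rfl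
    have hC0 : ∀ ω, 0 ≤ 2 * C := fun ω => (abs_nonneg _).trans (hDC n ω)
    have hcross : Integrable (fun ω => (∑ k ∈ Finset.range n, D k ω) * D n ω) P := by
      refine integrable_of_measurable_bdd (C := n * (2 * C) * (2 * C)) (hSM.mul hDM) fun ω => ?_
      rw [abs_mul]
      exact mul_le_mul (hSC n ω) (hDC n ω) (abs_nonneg _)
        (mul_nonneg (Nat.cast_nonneg _) (hC0 ω))
    have hsq : ∀ ω, D n ω ^ 2 ≤ (2 * C) ^ 2 := fun ω => by
      rw [← sq_abs]
      exact pow_le_pow_left₀ (abs_nonneg _) (hDC n ω) 2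
    have hD2 : Integrable (fun ω => D n ω ^ 2) P := by
      refine integrable_of_measurable_bdd (C := (2 * C) ^ 2) (hDM.pow_const 2) fun ω => ?_
      rw [abs_of_nonneg (sq_nonneg _)]
      exact hsq ω
    have hzero : ∫ ω, (∑ k ∈ Finset.range n, D k ω) * D n ω ∂P = 0 := by
      have hterm : ∀ s, Measurable[ℱ n] fun ω => (∑ k ∈ Finset.range n, D k ω) * V n ω s :=
        fun s => (hSm n).mul (hV n s)
      have hbd : ∀ s ω, |(∑ k ∈ Finset.range n, D k ω) * V n ω s| ≤ n * (2 * C) * C := by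
        intro s ω
        rw [abs_mul]
        exact mul_le_mul (hSC n ω) (hVC n ω s) (abs_nonneg _)
          (mul_nonneg (Nat.cast_nonneg _) (hC0 ω))
      have hY : ∀ s, Integrable (fun ω => if ξ (n + 1) ω = s then (1 : ℝ) else 0) P := by
        intro s
        refine integrable_of_measurable_bdd (C := 1) ?_ fun ω => by split_ifs <;> simp
        exact Measurable.ite (((hξ (n + 1)).mono (ℱ.le _) le_rfl) (measurableSet_singleton s))
          measurable_const measurable_const
      have hq : ∀ s, Integrable (fun ω => K (n + 1) ω (ξ n ω) s) P := fun s =>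
        integrable_condExp.congr (hM n s)
      have hrw : ∀ ω, (∑ k ∈ Finset.range n, D k ω) * D n ω =
          ∑ s, ((∑ k ∈ Finset.range n, D k ω) * V n ω s) *
            ((if ξ (n + 1) ω = s then (1 : ℝ) else 0) - K (n + 1) ω (ξ n ω) s) := by
        intro ω
        rw [hDsum n ω, Finset.mul_sum]
        exact Finset.sum_congr rfl fun s _ => (mul_assoc _ _ _).symm
      simp only [hrw]
      rw [integral_finsetSum]
      · exact Finset.sum_eq_zero fun s _ =>
          integral_mul_sub_condExp_eq_zero (ℱ.le n) (hterm s) (hbd s) (hY s) (hM n s)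
      · intro s _
        exact ((hY s).sub (hq s)).bdd_mul
          ((hterm s).mono (ℱ.le n) le_rfl).aestronglyMeasurable
          (Eventually.of_forall (hbd s))
    have hexp : ∀ ω, (∑ k ∈ Finset.range (n + 1), D k ω) ^ 2 =
        (∑ k ∈ Finset.range n, D k ω) ^ 2 + 2 * ((∑ k ∈ Finset.range n, D k ω) * D n ω)
          + D n ω ^ 2 := by
      intro ω; rw [Finset.sum_range_succ]; ring
    have hD2le : ∫ ω, D n ω ^ 2 ∂P ≤ (2 * C) ^ 2 := by
      calc ∫ ω, D n ω ^ 2 ∂P ≤ ∫ _ω, (2 * C) ^ 2 ∂P :=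
            integral_mono hD2 (integrable_const _) hsq
        _ = (2 * C) ^ 2 := by simp
    simp only [hexp]
    have hadd : Integrable (fun ω => (∑ k ∈ Finset.range n, D k ω) ^ 2 +
        2 * ((∑ k ∈ Finset.range n, D k ω) * D n ω)) P := (hSint n).add (hcross.const_mul 2)
    rw [integral_add hadd hD2,
      integral_add (hSint n) (hcross.const_mul 2), integral_const_mul, hzero]
    push_cast
    linarith

end Martingale

section SlowChain

/-- A controlled Markov chain `ξ` on a finite set, with transition kernel `K (k + 1)` from time `k`
to time `k + 1`, whose kernels have stationary distributions `d k` and whose kernels and observables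
`h k` vary by at most `C / N` per step. -/
structure SlowChain {Ω S : Type*} [Fintype S] [DecidableEq S] [MeasurableSpace S]
    {mΩ : MeasurableSpace Ω} (P : Measure Ω) (ℱ : Filtration ℕ mΩ) (ξ : ℕ → Ω → S)
    (K : ℕ → Ω → S → S → ℝ) (d h V : ℕ → Ω → S → ℝ) (C β : ℝ) (n₀ N n : ℕ) : Prop where
  adapted : ∀ k, Measurable[ℱ k] (ξ k)
  stochastic : ∀ k ω, IsStochastic (K k ω)
  kernel_adapted : ∀ k s s', Measurable[ℱ k] fun ω => K k ω s s'
  kernel_predictable : ∀ k s s', Measurable[ℱ k] fun ω => K (k + 1) ω s s'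
  obs_adapted : ∀ k s, Measurable[ℱ k] fun ω => h k ω s
  incr_adapted : ∀ k s, Measurable[ℱ k] fun ω => V k ω s
  obs_bdd : ∀ k ω s, |h k ω s| ≤ C
  incr_bdd : ∀ k ω s, |V k ω s| ≤ C
  obs_slow : ∀ k ω s, |h (k + 1) ω s - h k ω s| ≤ C / N
  kernel_slow : ∀ k ω s, ∑ s', |K (k + 1) ω s s' - K k ω s s'| ≤ C / N
  markov : ∀ k s, P[(fun ω => if ξ (k + 1) ω = s then (1 : ℝ) else 0)|ℱ k]
      =ᵐ[P] fun ω => K (k + 1) ω (ξ k ω) s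
  stationary : ∀ k ω, IsStationaryDist (K k ω) (d k ω)
  doeblin : ∀ k < n, ∀ ω s s', β ≤ kpow (K k ω) n₀ s s'

lemma abs_sum_sub_martingale_le {S : Type*} [Fintype S] {ξ : ℕ → S} {K : ℕ → S → S → ℝ}
    {h : ℕ → S → ℝ} {c : ℕ → ℝ} {C e ε : ℝ} {L n : ℕ} (he : 0 ≤ e) (hC : 0 ≤ C)
    (hK : ∀ k, IsStochastic (K k)) (hh : ∀ k s, |h k s| ≤ C)
    (hslow : ∀ k s, |h (k + 1) s - h k s| ≤ e)
    (hKslow : ∀ k s, ∑ s', |K (k + 1) s s' - K k s s'| ≤ e)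
    (herg : ∀ k < n, ∀ s, |(kernelApp (K k))^[L] (h k) s - c k| ≤ ε) :
    |∑ k ∈ Finset.range n, (h k (ξ k) - c k) -
      ∑ k ∈ Finset.range n, (truncPoisson (K k) (h k) L (ξ (k + 1)) -
        kernelApp (K (k + 1)) (truncPoisson (K k) (h k) L) (ξ k))|
      ≤ 2 * (L * C) + n * (L * (e + L * (e * C)) + e * (L * C) + ε) := by
  set ν : ℕ → S → ℝ := fun k => truncPoisson (K k) (h k) L with hν
  have hνb : ∀ k s, |ν k s| ≤ L * C := fun k s => (hK k).abs_truncPoisson_le (hh k) L s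
  have hdec : ∀ k, (h k (ξ k) - c k) - (ν k (ξ (k + 1)) - kernelApp (K (k + 1)) (ν k) (ξ k)) =
      (ν k (ξ k) - ν (k + 1) (ξ (k + 1))) + ((ν (k + 1) (ξ (k + 1)) - ν k (ξ (k + 1))) +
        (kernelApp (K (k + 1)) (ν k) (ξ k) - kernelApp (K k) (ν k) (ξ k)) +
        ((kernelApp (K k))^[L] (h k) (ξ k) - c k)) := by
    intro k
    have := truncPoisson_sub_kernelApp (K k) (h k) L (ξ k)
    simp only [hν]
    linarith
  rw [← Finset.sum_sub_distrib]
  refine (congrArg abs (Finset.sum_congr rfl fun k _ => hdec k)).le.trans ?_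
  rw [Finset.sum_add_distrib, Finset.sum_range_sub' (fun k => ν k (ξ k))]
  refine (abs_add_le _ _).trans (add_le_add ?_ ?_)
  · have h1 := hνb 0 (ξ 0)
    have h2 := hνb n (ξ n)
    have h3 := abs_sub (ν 0 (ξ 0)) (ν n (ξ n))
    linarith
  · refine (Finset.abs_sum_le_sum_abs _ _).trans ?_
    rw [← nsmul_eq_mul]
    refine (Finset.sum_le_card_nsmul _ _ _ fun k hk => ?_).trans_eq (by rw [Finset.card_range])
    refine (abs_add_le _ _).trans (add_le_add ((abs_add_le _ _).trans (add_le_add ?_ ?_)) ?_)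
    · exact abs_truncPoisson_sub_le (hK (k + 1)) (hK k) hC he (hh k) (hslow k) (hKslow k) L _
    · exact abs_kernelApp_sub_le (hνb k) (hKslow k) (by positivity) _
    · exact herg k (Finset.mem_range.1 hk) _

/-- Uniform `L¹` averaging for slowly varying controlled Markov chains. -/
theorem SlowChain.exists_forall_integral_le {Ω S : Type*} [Fintype S] [DecidableEq S] [Nonempty S]
    [MeasurableSpace S] [MeasurableSingletonClass S] {mΩ : MeasurableSpace Ω} (P : Measure Ω)
    [IsProbabilityMeasure P] {C β T ε : ℝ} (hC : 0 ≤ C) (hβ : 0 < β) (hβ1 : β ≤ 1) (hT : 0 < T)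
    (hε : 0 < ε) (n₀ : ℕ) :
    ∃ N₀ : ℕ, ∀ N ≥ N₀, ∀ n : ℕ, (n : ℝ) ≤ N * T → ∀ (ℱ : Filtration ℕ mΩ) (ξ : ℕ → Ω → S)
      (K : ℕ → Ω → S → S → ℝ) (d h V : ℕ → Ω → S → ℝ), SlowChain P ℱ ξ K d h V C β n₀ N n →
      ∫ ω, |1 / (N : ℝ) * ∑ k ∈ Finset.range n, (h k ω (ξ k ω) - ∑ s, d k ω s * h k ω s +
        (V k ω (ξ (k + 1) ω) - kernelApp (K (k + 1) ω) (V k ω) (ξ k ω)))| ∂P ≤ ε := by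
  obtain ⟨m, hm⟩ : ∃ m : ℕ, (1 - β) ^ m * (2 * C) ≤ ε / (4 * T) := by
    have h := (tendsto_pow_atTop_nhds_zero_of_lt_one (sub_nonneg.2 hβ1)
      (by linarith : 1 - β < 1)).mul_const (2 * C)
    rw [zero_mul] at h
    exact ((h.eventually_lt_const (by positivity : (0 : ℝ) < ε / (4 * T))).exists).imp
      fun _ h => h.le
  set L := n₀ * m with hL
  set c : ℝ := L * (C + L * (C * C)) + C * (L * C) with hc
  set B : ℝ := T * (2 * (L * C + C)) ^ 2 / (ε / 4) + 2 * (L * C) + T * c with hB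
  have hc0 : 0 ≤ c := by positivity
  have hB0 : 0 ≤ B := by positivity
  refine ⟨⌈2 * B / ε⌉₊ + 1, fun N hN n hn ℱ ξ K d h V H => ?_⟩
  have hN1 : 1 ≤ N := le_trans (Nat.le_add_left _ _) hN
  have hNpos : (0 : ℝ) < N := by exact_mod_cast hN1
  have hBN : B / N ≤ ε / 2 := by
    have h1 : 2 * B / ε ≤ N :=
      (Nat.le_ceil _).trans (by exact_mod_cast (Nat.le_succ _).trans hN)
    rw [div_le_iff₀ hε] at h1
    rw [div_le_iff₀ hNpos]
    linarith
  set W : ℕ → Ω → S → ℝ := fun k ω s => truncPoisson (K k ω) (h k ω) L s + V k ω s with hW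
  set Z : Ω → ℝ := fun ω => ∑ k ∈ Finset.range n,
    (W k ω (ξ (k + 1) ω) - kernelApp (K (k + 1) ω) (W k ω) (ξ k ω)) with hZ
  obtain ⟨hZi, hZ2⟩ := integral_sq_sum_martingale_le (P := P) (V := W) (C := L * C + C) H.adapted
    H.stochastic H.kernel_predictable
    (fun k s => (measurable_truncPoisson (m := ℱ k) (H.kernel_adapted k) (H.obs_adapted k) L s).add
      (H.incr_adapted k s))
    (fun k ω s => (abs_add_le _ _).trans (add_le_add
      ((H.stochastic k ω).abs_truncPoisson_le (H.obs_bdd k ω) L s) (H.incr_bdd k ω s)))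
    H.markov n
  change Integrable (fun ω => Z ω ^ 2) P at hZi
  change ∫ ω, Z ω ^ 2 ∂P ≤ _ at hZ2
  set R : ℝ := 2 * (L * C) +
    n * (L * (C / N + L * (C / N * C)) + C / N * (L * C) + ε / (4 * T)) with hR
  have hpath : ∀ ω, |1 / (N : ℝ) * ∑ k ∈ Finset.range n, (h k ω (ξ k ω) - ∑ s, d k ω s * h k ω s +
        (V k ω (ξ (k + 1) ω) - kernelApp (K (k + 1) ω) (V k ω) (ξ k ω)))|
      ≤ (ε / 4 + R / N) + 1 / (ε / 4 * N ^ 2) * Z ω ^ 2 := by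
    intro ω
    have h1 := abs_sum_sub_martingale_le (ξ := fun k => ξ k ω) (K := fun k => K k ω)
      (h := fun k => h k ω) (c := fun k => ∑ s, d k ω s * h k ω s) (C := C) (e := C / N)
      (ε := ε / (4 * T)) (L := L) (n := n) (by positivity) hC (fun k => H.stochastic k ω)
      (fun k => H.obs_bdd k ω) (fun k => H.obs_slow k ω) (fun k => H.kernel_slow k ω)
      (fun k hk s => ((H.stationary k ω).abs_iterate_sub_le (H.stochastic k ω)
        (H.doeblin k hk ω) (H.obs_bdd k ω) m s).trans hm)
    set X := ∑ k ∈ Finset.range n, (h k ω (ξ k ω) - ∑ s, d k ω s * h k ω s +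
        (V k ω (ξ (k + 1) ω) - kernelApp (K (k + 1) ω) (V k ω) (ξ k ω))) with hX
    have h2 : |X - Z ω| ≤ R := by
      refine le_trans (le_of_eq ?_) h1
      congr 1
      rw [hX, hZ, ← Finset.sum_sub_distrib, ← Finset.sum_sub_distrib]
      refine Finset.sum_congr rfl fun k _ => ?_
      simp only [hW]
      rw [kernelApp_add]
      ring
    have h3 : |X| ≤ |Z ω| + R := by
      have := abs_sub_abs_le_abs_sub X (Z ω)
      linarith
    have h4 : |Z ω| / N ≤ ε / 4 + 1 / (ε / 4 * N ^ 2) * Z ω ^ 2 := by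
      have h5 : 1 / (ε / 4 * N ^ 2) * Z ω ^ 2 = (|Z ω| / N) ^ 2 / (ε / 4) := by
        rw [div_pow, sq_abs]; field_simp
      rw [h5]
      set y := |Z ω| / N
      have : y * (ε / 4) ≤ (ε / 4 + y ^ 2 / (ε / 4)) * (ε / 4) := by
        rw [add_mul, div_mul_cancel₀ _ (by positivity : ε / 4 ≠ 0)]
        nlinarith [sq_nonneg (y - ε / 4), sq_nonneg y, sq_nonneg ε]
      exact le_of_mul_le_mul_right this (by positivity)
    rw [abs_mul, abs_of_pos (by positivity : (0 : ℝ) < 1 / N)]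
    calc 1 / (N : ℝ) * |X| ≤ 1 / N * (|Z ω| + R) := by gcongr
      _ = |Z ω| / N + R / N := by ring
      _ ≤ _ := by linarith
  have hRN : R / N + 1 / (ε / 4 * N ^ 2) * (n * (2 * (L * C + C)) ^ 2) ≤ ε / 4 + B / N := by
    have h1 : (n : ℝ) / N ≤ T := by rw [div_le_iff₀ hNpos]; linarith
    have h2 : R / N = 2 * (L * C) / N + n / N * (c / N + ε / (4 * T)) := by
      rw [hR, hc]; ring
    have h3 : 1 / (ε / 4 * N ^ 2) * (n * (2 * (L * C + C)) ^ 2)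
        = n / N * ((2 * (L * C + C)) ^ 2 / (ε / 4) / N) := by
      field_simp
    have h4 : T * (c / N + ε / (4 * T)) = T * c / N + ε / 4 := by field_simp
    have h5 : n / N * (c / N + ε / (4 * T)) ≤ T * (c / N + ε / (4 * T)) :=
      mul_le_mul_of_nonneg_right h1 (by positivity)
    have h6 : n / N * ((2 * (L * C + C)) ^ 2 / (ε / 4) / N)
        ≤ T * ((2 * (L * C + C)) ^ 2 / (ε / 4) / N) :=
      mul_le_mul_of_nonneg_right h1 (by positivity)
    have h7 : B / N = T * ((2 * (L * C + C)) ^ 2 / (ε / 4) / N) + 2 * (L * C) / N + T * c / N := by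
      rw [hB]; ring
    rw [h2, h3, h7]
    linarith
  calc _ ≤ ∫ ω, ((ε / 4 + R / N) + 1 / (ε / 4 * N ^ 2) * Z ω ^ 2) ∂P :=
        integral_mono_of_nonneg (Eventually.of_forall fun ω => abs_nonneg _)
          ((integrable_const _).add (hZi.const_mul _)) (Eventually.of_forall hpath)
    _ = (ε / 4 + R / N) + 1 / (ε / 4 * N ^ 2) * ∫ ω, Z ω ^ 2 ∂P := by
        rw [integral_add (integrable_const _) (hZi.const_mul _), integral_const_mul]
        simp
    _ ≤ (ε / 4 + R / N) + 1 / (ε / 4 * N ^ 2) * (n * (2 * (L * C + C)) ^ 2) := by gcongr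
    _ ≤ ε := by linarith

/-- Uniform-in-time `L¹` averaging for a family of slowly varying controlled Markov chains. -/
theorem SlowChain.tendsto_iSup_integral {Ω S : Type*} [Fintype S] [DecidableEq S] [Nonempty S]
    [MeasurableSpace S] [MeasurableSingletonClass S] {mΩ : MeasurableSpace Ω} {P : Measure Ω}
    [IsProbabilityMeasure P] {C β T : ℝ} {n₀ N₁ : ℕ} {ℱ : ℕ → Filtration ℕ mΩ}
    {ξ : ℕ → ℕ → Ω → S} {K : ℕ → ℕ → Ω → S → S → ℝ} {d h V : ℕ → ℕ → Ω → S → ℝ}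
    (hC : 0 ≤ C) (hβ : 0 < β) (hβ1 : β ≤ 1) (hT : 0 < T)
    (H : ∀ N ≥ N₁, ∀ n : ℕ, (n : ℝ) ≤ N * T →
      SlowChain P (ℱ N) (ξ N) (K N) (d N) (h N) (V N) C β n₀ N n) :
    Tendsto (fun N : ℕ => ⨆ t : Set.Ioc (0 : ℝ) T, ∫ ω, |1 / (N : ℝ) *
      ∑ k ∈ Finset.range ⌊(N : ℝ) * (t : ℝ)⌋₊, (h N k ω (ξ N k ω) - ∑ s, d N k ω s * h N k ω s +
        (V N k ω (ξ N (k + 1) ω) - kernelApp (K N (k + 1) ω) (V N k ω) (ξ N k ω)))| ∂P)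
      atTop (nhds 0) := by
  rw [Metric.tendsto_atTop]
  intro ε hε
  obtain ⟨N₀, hN₀⟩ := SlowChain.exists_forall_integral_le (S := S) P hC hβ hβ1 hT (half_pos hε) n₀
  refine ⟨max N₀ N₁, fun N hN => ?_⟩
  rw [Real.dist_0_eq_abs, abs_of_nonneg
    (Real.iSup_nonneg fun t => integral_nonneg fun ω => abs_nonneg _)]
  refine lt_of_le_of_lt (Real.iSup_le (fun t => ?_) (half_pos hε).le) (half_lt_self hε)
  have hn : ((⌊(N : ℝ) * (t : ℝ)⌋₊ : ℕ) : ℝ) ≤ N * T :=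
    (Nat.floor_le (mul_nonneg (Nat.cast_nonneg _) t.2.1.le)).trans
      (mul_le_mul_of_nonneg_left t.2.2 (Nat.cast_nonneg _))
  exact hN₀ N ((le_max_left _ _).trans hN) _ hn _ _ _ _ _ _
    (H N ((le_max_right _ _).trans hN) _ hn)

end SlowChain

section Policy

lemma abs_sum_mul_le_of_sum_eq_one {ι : Type*} [Fintype ι] {w u : ι → ℝ} {C : ℝ}
    (hw : ∀ i, 0 ≤ w i) (hw1 : ∑ i, w i = 1) (hu : ∀ i, |u i| ≤ C) : |∑ i, w i * u i| ≤ C := by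
  calc |∑ i, w i * u i| ≤ ∑ i, |w i * u i| := Finset.abs_sum_le_sum_abs _ _
    _ ≤ ∑ i, w i * C := by
        refine Finset.sum_le_sum fun i _ => ?_
        rw [abs_mul, abs_of_nonneg (hw i)]
        exact mul_le_mul_of_nonneg_left (hu i) (hw i)
    _ = C := by rw [← Finset.sum_mul, hw1, one_mul]

variable {X A : Type*} [Fintype A]

lemma IsPolicy.le_one {f : X → A → ℝ} (hf : IsPolicy f) (x : X) (a : A) : f x a ≤ 1 := by
  rw [← hf.2 x]
  exact Finset.single_le_sum (fun a _ => hf.1 x a) (Finset.mem_univ a)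

lemma explorePol_one_eq (θ : X → A → ℝ) : explorePol 1 θ = explorePol 0 (0 : X → A → ℝ) := by
  funext x a
  simp [explorePol, softmaxPol]

lemma measurable_softmaxPol {Ω : Type*} {m : MeasurableSpace Ω} {θ : Ω → X → A → ℝ}
    (hθ : ∀ x a, Measurable fun ω => θ ω x a) (x : X) (a : A) :
    Measurable fun ω => softmaxPol (θ ω) x a :=
  (Real.measurable_exp.comp (hθ x a)).div
    (Finset.measurable_sum _ fun a' _ => Real.measurable_exp.comp (hθ x a'))

lemma measurable_explorePol {Ω : Type*} {m : MeasurableSpace Ω} {θ : Ω → X → A → ℝ}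
    (hθ : ∀ x a, Measurable fun ω => θ ω x a) (η : ℝ) (x : X) (a : A) :
    Measurable fun ω => explorePol η (θ ω) x a :=
  ((measurable_softmaxPol hθ x a).const_mul _).const_add _

variable [Nonempty A]

lemma sum_exp_pos (θ : X → A → ℝ) (x : X) : 0 < ∑ a, Real.exp (θ x a) :=
  Finset.sum_pos (fun _ _ => Real.exp_pos _) Finset.univ_nonempty

lemma isPolicy_softmaxPol (θ : X → A → ℝ) : IsPolicy (softmaxPol θ) := by
  refine ⟨fun x a => div_nonneg (Real.exp_pos _).le (sum_exp_pos θ x).le, fun x => ?_⟩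
  simp only [softmaxPol]
  rw [← Finset.sum_div, div_self (sum_exp_pos θ x).ne']

lemma isPolicy_explorePol {η : ℝ} (h0 : 0 ≤ η) (h1 : η ≤ 1) (θ : X → A → ℝ) :
    IsPolicy (explorePol η θ) := by
  refine ⟨fun x a => add_nonneg (by positivity)
    (mul_nonneg (by linarith) ((isPolicy_softmaxPol θ).1 x a)), fun x => ?_⟩
  have hc : (Fintype.card A : ℝ) ≠ 0 := by exact_mod_cast Fintype.card_ne_zero
  simp only [explorePol, Finset.sum_add_distrib, ← Finset.mul_sum, (isPolicy_softmaxPol θ).2 x,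
    Finset.sum_const, Finset.card_univ, nsmul_eq_mul]
  field_simp
  ring

lemma le_softmaxPol {θ : X → A → ℝ} {B : ℝ} (hB : ∀ x a, |θ x a| ≤ B) (x : X) (a : A) :
    Real.exp (-(2 * B)) / Fintype.card A ≤ softmaxPol θ x a := by
  have hc : (0 : ℝ) < Fintype.card A := by exact_mod_cast Fintype.card_pos
  rw [softmaxPol, div_le_div_iff₀ hc (sum_exp_pos θ x)]
  have h1 : ∑ a', Real.exp (θ x a') ≤ Fintype.card A * Real.exp B := by
    calc _ ≤ ∑ _a' : A, Real.exp B :=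
          Finset.sum_le_sum fun a' _ => Real.exp_le_exp.2 (abs_le.1 (hB x a')).2
      _ = _ := by simp
  have h2 : Real.exp (-B) ≤ Real.exp (θ x a) := Real.exp_le_exp.2 (abs_le.1 (hB x a)).1
  calc Real.exp (-(2 * B)) * ∑ a', Real.exp (θ x a')
      ≤ Real.exp (-(2 * B)) * (Fintype.card A * Real.exp B) := by gcongr
    _ = Real.exp (-B) * Fintype.card A := by
        rw [show -(2 * B) = -B + -B by ring, Real.exp_add, Real.exp_neg]
        field_simp
    _ ≤ _ := by gcongr

lemma le_explorePol {η : ℝ} (h0 : 0 ≤ η) (h1 : η ≤ 1) {θ : X → A → ℝ} {B : ℝ}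
    (hB0 : 0 ≤ B) (hB : ∀ x a, |θ x a| ≤ B) (x : X) (a : A) :
    Real.exp (-(2 * B)) / Fintype.card A ≤ explorePol η θ x a := by
  have h2 := le_softmaxPol hB x a
  have h3 : Real.exp (-(2 * B)) ≤ 1 := Real.exp_le_one_iff.2 (by linarith)
  have h4 : Real.exp (-(2 * B)) / Fintype.card A ≤ 1 / Fintype.card A := by gcongr
  have h5 := mul_le_mul_of_nonneg_left h4 h0
  have h6 := mul_le_mul_of_nonneg_left h2 (sub_nonneg.2 h1)
  have h7 : η * (1 / (Fintype.card A : ℝ)) = η / Fintype.card A := mul_one_div _ _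
  rw [explorePol]
  linarith

lemma softmaxPol_sub_le {θ θ' : X → A → ℝ} {D : ℝ} (hD : ∀ x a, |θ' x a - θ x a| ≤ D)
    (x : X) (a : A) : softmaxPol θ x a - softmaxPol θ' x a ≤ 2 * D := by
  have hD0 : 0 ≤ D := (abs_nonneg _).trans (hD x a)
  have h1 : ∑ a', Real.exp (θ' x a') ≤ Real.exp D * ∑ a', Real.exp (θ x a') := by
    rw [Finset.mul_sum]
    refine Finset.sum_le_sum fun a' _ => ?_
    rw [← Real.exp_add]
    exact Real.exp_le_exp.2 (by linarith [(abs_le.1 (hD x a')).2])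
  have h2 : Real.exp (-D) * Real.exp (θ x a) ≤ Real.exp (θ' x a) := by
    rw [← Real.exp_add]
    exact Real.exp_le_exp.2 (by linarith [(abs_le.1 (hD x a)).1])
  have h3 : Real.exp (-(2 * D)) * softmaxPol θ x a ≤ softmaxPol θ' x a := by
    rw [softmaxPol, softmaxPol, ← mul_div_assoc, div_le_div_iff₀ (sum_exp_pos θ x)
      (sum_exp_pos θ' x)]
    calc Real.exp (-(2 * D)) * Real.exp (θ x a) * ∑ a', Real.exp (θ' x a')
        ≤ Real.exp (-(2 * D)) * Real.exp (θ x a) *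
          (Real.exp D * ∑ a', Real.exp (θ x a')) := by gcongr
      _ = (Real.exp (-D) * Real.exp (θ x a)) * ∑ a', Real.exp (θ x a') := by
          rw [show -(2 * D) = -D + -D by ring, Real.exp_add, Real.exp_neg]
          field_simp
      _ ≤ _ := mul_le_mul_of_nonneg_right h2 (sum_exp_pos θ x).le
  have h4 : 1 - 2 * D ≤ Real.exp (-(2 * D)) := by linarith [Real.add_one_le_exp (-(2 * D))]
  have h5 := mul_le_mul_of_nonneg_right h4 ((isPolicy_softmaxPol θ).1 x a)
  have h6 := mul_le_mul_of_nonneg_left ((isPolicy_softmaxPol θ).le_one x a)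
    (by linarith : 0 ≤ 2 * D)
  linarith

lemma abs_softmaxPol_sub_le {θ θ' : X → A → ℝ} {D : ℝ} (hD : ∀ x a, |θ' x a - θ x a| ≤ D)
    (x : X) (a : A) : |softmaxPol θ' x a - softmaxPol θ x a| ≤ 2 * D := by
  refine abs_sub_le_iff.2 ⟨softmaxPol_sub_le (fun x a => ?_) x a, softmaxPol_sub_le hD x a⟩
  rw [abs_sub_comm]
  exact hD x a

lemma abs_explorePol_sub_le {η η' e D : ℝ} (h0 : 0 ≤ η) (h1 : η ≤ 1) (he : |η' - η| ≤ e)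
    {θ θ' : X → A → ℝ} (hD : ∀ x a, |θ' x a - θ x a| ≤ D) (x : X) (a : A) :
    |explorePol η' θ' x a - explorePol η θ x a| ≤ e + 2 * D := by
  have h2 := abs_softmaxPol_sub_le hD x a
  have hf0 := (isPolicy_softmaxPol θ').1 x a
  have hf1 := (isPolicy_softmaxPol θ').le_one x a
  have hc : (1 : ℝ) ≤ Fintype.card A := by exact_mod_cast Fintype.card_pos
  have hc0 : 0 ≤ 1 / (Fintype.card A : ℝ) := by positivity
  have hc1 : 1 / (Fintype.card A : ℝ) ≤ 1 := by
    rw [div_le_one (by linarith)]; exact hc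
  have h3 : |1 / (Fintype.card A : ℝ) - softmaxPol θ' x a| ≤ 1 :=
    abs_le.2 ⟨by linarith, by linarith⟩
  have h4 : explorePol η' θ' x a - explorePol η θ x a =
      (η' - η) * (1 / (Fintype.card A : ℝ) - softmaxPol θ' x a) +
        (1 - η) * (softmaxPol θ' x a - softmaxPol θ x a) := by
    simp only [explorePol]; ring
  rw [h4]
  refine (abs_add_le _ _).trans (add_le_add ?_ ?_)
  · rw [abs_mul]
    calc _ ≤ e * 1 := mul_le_mul he h3 (abs_nonneg _) ((abs_nonneg _).trans he)
      _ = e := mul_one e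
  · rw [abs_mul, abs_of_nonneg (sub_nonneg.2 h1)]
    calc _ ≤ 1 * (2 * D) :=
          mul_le_mul (by linarith) h2 (abs_nonneg _) zero_le_one
      _ = 2 * D := one_mul _

lemma etaN_mem (N k : ℕ) : 0 ≤ etaN N k ∧ etaN N k ≤ 1 := by
  have h : 1 ≤ 1 + (Real.log ((k : ℝ) / (N : ℝ) + 1)) ^ 2 := by
    linarith [sq_nonneg (Real.log ((k : ℝ) / (N : ℝ) + 1))]
  exact ⟨inv_nonneg.2 (by linarith), inv_le_one_of_one_le₀ h⟩

lemma zetaN_mem (N k : ℕ) : 0 ≤ zetaN N k ∧ zetaN N k ≤ 1 := by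
  have h : (1 : ℝ) ≤ 1 + (k : ℝ) / (N : ℝ) := by
    have : (0 : ℝ) ≤ (k : ℝ) / (N : ℝ) := by positivity
    linarith
  exact ⟨inv_nonneg.2 (by linarith), inv_le_one_of_one_le₀ h⟩

lemma abs_inv_one_add_sq_sub_le (u v : ℝ) :
    |(1 + u ^ 2)⁻¹ - (1 + v ^ 2)⁻¹| ≤ |u - v| := by
  have hu : 0 < 1 + u ^ 2 := by positivity
  have hv : 0 < 1 + v ^ 2 := by positivity
  have h : (1 + u ^ 2)⁻¹ - (1 + v ^ 2)⁻¹ = (u - v) * (-(u + v) / ((1 + u ^ 2) * (1 + v ^ 2))) := by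
    field_simp; ring
  rw [h, abs_mul]
  refine mul_le_of_le_one_right (abs_nonneg _) ?_
  rw [abs_div, abs_of_pos (mul_pos hu hv), div_le_one (mul_pos hu hv), abs_neg]
  refine abs_le.2 ⟨?_, ?_⟩
  · nlinarith [sq_nonneg (u + 1), sq_nonneg (v + 1), mul_nonneg (sq_nonneg u) (sq_nonneg v)]
  · nlinarith [sq_nonneg (u - 1), sq_nonneg (v - 1), mul_nonneg (sq_nonneg u) (sq_nonneg v)]

lemma abs_etaN_succ_sub_le {N : ℕ} (hN : 0 < N) (k : ℕ) :
    |etaN N (k + 1) - etaN N k| ≤ 1 / N := by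
  have hN' : (0 : ℝ) < N := by exact_mod_cast hN
  refine (abs_inv_one_add_sq_sub_le _ _).trans ?_
  have hk : (0 : ℝ) ≤ (k : ℝ) / N := by positivity
  have hs : ((k + 1 : ℕ) : ℝ) / N + 1 = ((k : ℝ) / N + 1) + 1 / N := by push_cast; ring
  have hN1 : (0 : ℝ) < 1 / N := by positivity
  set b : ℝ := (k : ℝ) / N + 1 with hb
  have hb1 : 1 ≤ b := by linarith
  have hb0 : 0 < b := by linarith
  rw [hs, ← Real.log_div (by linarith) (by linarith)]
  have h1 : (b + 1 / N) / b = 1 + 1 / N / b := by field_simp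
  have h2 : (0 : ℝ) ≤ 1 / N / b := by positivity
  rw [h1, abs_of_nonneg (Real.log_nonneg (by linarith))]
  calc Real.log (1 + 1 / N / b) ≤ (1 + 1 / N / b) - 1 :=
        Real.log_le_sub_one_of_pos (by linarith)
    _ = 1 / N / b := by ring
    _ ≤ 1 / N := div_le_self hN1.le hb1

end Policy

section CriticKernel

variable {X A : Type*} [Fintype X] [Fintype A] {p : X → A → X → ℝ}

lemma isStochastic_criticKer (hp0 : ∀ x a x', 0 ≤ p x a x') (hp1 : ∀ x a, ∑ x', p x a x' = 1)
    {f : X → A → ℝ} (hf : IsPolicy f) : IsStochastic (criticKer p f) := by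
  refine ⟨fun s s' => mul_nonneg (hp0 _ _ _) (hf.1 _ _), fun s => ?_⟩
  simp only [criticKer, Fintype.sum_prod_type, ← Finset.mul_sum, hf.2, mul_one, hp1]

lemma kernelApp_criticKer_fst {f : X → A → ℝ} (hf : IsPolicy f) (v : X → ℝ) (s : X × A) :
    kernelApp (criticKer p f) (fun s' => v s'.1) s = ∑ z, p s.1 s.2 z * v z := by
  simp only [kernelApp, criticKer, Fintype.sum_prod_type]
  refine Finset.sum_congr rfl fun z _ => ?_
  rw [← Finset.sum_mul, ← Finset.mul_sum, hf.2, mul_one]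

lemma sum_abs_criticKer_sub_le (hp0 : ∀ x a x', 0 ≤ p x a x')
    (hp1 : ∀ x a, ∑ x', p x a x' = 1) {f f' : X → A → ℝ} {D : ℝ}
    (hD : ∀ x a, |f' x a - f x a| ≤ D) (s : X × A) :
    ∑ s', |criticKer p f' s s' - criticKer p f s s'| ≤ Fintype.card A * D := by
  calc ∑ s', |criticKer p f' s s' - criticKer p f s s'|
      ≤ ∑ s' : X × A, p s.1 s.2 s'.1 * D := by
        refine Finset.sum_le_sum fun s' _ => ?_
        rw [criticKer, criticKer, ← mul_sub, abs_mul, abs_of_nonneg (hp0 _ _ _)]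
        exact mul_le_mul_of_nonneg_left (hD _ _) (hp0 _ _ _)
    _ = Fintype.card A * D := by
        rw [Fintype.sum_prod_type]
        simp only [Finset.sum_const, Finset.card_univ, nsmul_eq_mul, ← Finset.mul_sum,
          ← Finset.sum_mul, hp1, one_mul]

/-- A minorization of the critic chain which is uniform over bounded policy parameters. -/
lemma exists_doeblin_criticKer [Nonempty X] [Nonempty A] [DecidableEq X] [DecidableEq A]
    (hp0 : ∀ x a x', 0 ≤ p x a x') (hp1 : ∀ x a, ∑ x', p x a x' = 1) {n₀ : ℕ}
    (hn₀ : ∀ s s' : X × A, 0 < kpow (criticKer p (explorePol 0 (0 : X → A → ℝ))) n₀ s s')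
    {B : ℝ} (hB : 0 ≤ B) :
    ∃ β : ℝ, 0 < β ∧ β ≤ 1 ∧ ∀ (η : ℝ) (θ : X → A → ℝ), 0 ≤ η → η ≤ 1 → (∀ x a, |θ x a| ≤ B) →
      ∀ s s', β ≤ kpow (criticKer p (explorePol η θ)) n₀ s s' := by
  set K₀ := criticKer p (explorePol 0 (0 : X → A → ℝ)) with hK₀
  have hpol : IsPolicy (explorePol 0 (0 : X → A → ℝ)) := isPolicy_explorePol le_rfl zero_le_one _
  have hst : IsStochastic K₀ := isStochastic_criticKer hp0 hp1 hpol
  obtain ⟨i, hi⟩ := Finite.exists_min fun i : (X × A) × (X × A) => kpow K₀ n₀ i.1 i.2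
  set δ : ℝ := Real.exp (-(2 * B)) / Fintype.card A with hδ
  have hc : (0 : ℝ) < Fintype.card A := by exact_mod_cast Fintype.card_pos
  have hδ0 : 0 < δ := div_pos (Real.exp_pos _) hc
  refine ⟨min (δ ^ n₀ * kpow K₀ n₀ i.1 i.2) 1,
    lt_min (mul_pos (pow_pos hδ0 _) (hn₀ _ _)) one_pos, min_le_right _ _,
    fun η θ h0 h1 hθ s s' => (min_le_left _ _).trans ?_⟩
  refine (mul_le_mul_of_nonneg_left (hi (s, s')) (pow_nonneg hδ0.le _)).trans ?_
  refine pow_mul_kpow_le hδ0.le hst (fun s s' => ?_) n₀ s s'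
  have h2 := le_explorePol h0 h1 hB hθ s'.1 s'.2
  have h3 := hpol.le_one s'.1 s'.2
  rw [hK₀, criticKer, criticKer]
  calc δ * (p s.1 s.2 s'.1 * explorePol 0 0 s'.1 s'.2)
      ≤ δ * (p s.1 s.2 s'.1 * 1) := by
        gcongr
        exact hp0 _ _ _
    _ = p s.1 s.2 s'.1 * δ := by ring
    _ ≤ _ := mul_le_mul_of_nonneg_left h2 (hp0 _ _ _)

end CriticKernel

section CriticIterates

variable {X A : Type*} {r : X → A → ℝ} {γ α : ℝ} {N : ℕ} {Q : ℕ → X → A → ℝ} {y : ℕ → X} {b : ℕ → A}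
  {g : ℕ → X → A → ℝ} {C : ℝ} {θ : ℕ → X → A → ℝ} {y' : ℕ → X} {b' : ℕ → A}

lemma abs_actor_le {B e : ℝ} (h0 : ∀ x a, |θ 0 x a| ≤ B)
    (hθ : ∀ k x a, |θ (k + 1) x a - θ k x a| ≤ e) (k : ℕ) (x : X) (a : A) :
    |θ k x a| ≤ B + k * e := by
  induction k with
  | zero => simpa using h0 x a
  | succ k ih =>
    have h1 := abs_sub_abs_le_abs_sub (θ (k + 1) x a) (θ k x a)
    have h2 := hθ k x a
    push_cast
    linarith

variable [Fintype A]

lemma abs_sum_mul_policy_le {f q : X → A → ℝ} (hf : IsPolicy f) (hq : ∀ x a, |q x a| ≤ C)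
    (x : X) : |∑ a, q x a * f x a| ≤ C := by
  simp only [mul_comm (q x _)]
  exact abs_sum_mul_le_of_sum_eq_one (hf.1 x) (hf.2 x) (hq x)

lemma abs_sum_mul_policy_sub_le {f f' q q' : X → A → ℝ} {e D : ℝ} (hf' : IsPolicy f')
    (hq : ∀ x a, |q x a| ≤ C) (he : ∀ x a, |q' x a - q x a| ≤ e)
    (hD : ∀ x a, |f' x a - f x a| ≤ D) (x : X) :
    |∑ a, q' x a * f' x a - ∑ a, q x a * f x a| ≤ e + Fintype.card A * (C * D) := by
  have h : ∑ a, q' x a * f' x a - ∑ a, q x a * f x a =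
      ∑ a, (q' x a - q x a) * f' x a + ∑ a, q x a * (f' x a - f x a) := by
    rw [← Finset.sum_sub_distrib, ← Finset.sum_add_distrib]
    exact Finset.sum_congr rfl fun a _ => by ring
  rw [h]
  refine (abs_add_le _ _).trans (add_le_add ?_ ?_)
  · exact abs_sum_mul_policy_le (q := fun x a => q' x a - q x a) hf' he x
  · refine (Finset.abs_sum_le_sum_abs _ _).trans ?_
    calc _ ≤ ∑ _a : A, C * D := by
          refine Finset.sum_le_sum fun a _ => ?_
          rw [abs_mul]
          exact mul_le_mul (hq x a) (hD x a) (abs_nonneg _) ((abs_nonneg _).trans (hq x a))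
      _ = _ := by simp

variable [DecidableEq X] [DecidableEq A]

lemma abs_critic_le (hr : ∀ x a, 0 ≤ r x a ∧ r x a ≤ 1) (hγ : 0 < γ ∧ γ < 1) (hα : 0 < α)
    (hN : 0 < N) (hαN : α ≤ N) (hg : ∀ k, IsPolicy (g k)) (h0 : ∀ x a, |Q 0 x a| ≤ C)
    (hC : 1 + γ * C ≤ C)
    (hQ : ∀ k x a, Q (k + 1) x a = Q k x a + (α / N) *
      (r (y k) (b k) + γ * (∑ a'', Q k (y (k + 1)) a'' * g k (y (k + 1)) a'') - Q k (y k) (b k)) *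
      (if y k = x ∧ b k = a then 1 else 0)) (k : ℕ) (x : X) (a : A) : |Q k x a| ≤ C := by
  have hN' : (0 : ℝ) < N := by exact_mod_cast hN
  induction k generalizing x a with
  | zero => exact h0 x a
  | succ k ih =>
    rw [hQ]
    split_ifs with h
    · obtain ⟨rfl, rfl⟩ := h
      set u := ∑ a'', Q k (y (k + 1)) a'' * g k (y (k + 1)) a'' with hu
      have hub : |u| ≤ C := abs_sum_mul_policy_le (hg k) ih _
      have hw : |r (y k) (b k) + γ * u| ≤ C := by
        refine (abs_add_le _ _).trans (le_trans (add_le_add ?_ ?_) hC)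
        · rw [abs_of_nonneg (hr _ _).1]; exact (hr _ _).2
        · rw [abs_mul, abs_of_pos hγ.1]
          exact mul_le_mul_of_nonneg_left hub hγ.1.le
      have hs0 : 0 ≤ α / N := by positivity
      have hs1 : α / N ≤ 1 := (div_le_one hN').2 hαN
      have h1 : Q k (y k) (b k) + α / N * (r (y k) (b k) + γ * u - Q k (y k) (b k)) * 1 =
          (1 - α / N) * Q k (y k) (b k) + α / N * (r (y k) (b k) + γ * u) := by ring
      rw [h1]
      calc _ ≤ |(1 - α / N) * Q k (y k) (b k)| + |α / N * (r (y k) (b k) + γ * u)| :=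
            abs_add_le _ _
        _ ≤ (1 - α / N) * C + α / N * C := by
            rw [abs_mul, abs_mul, abs_of_nonneg hs0, abs_of_nonneg (sub_nonneg.2 hs1)]
            exact add_le_add (mul_le_mul_of_nonneg_left (ih _ _) (sub_nonneg.2 hs1))
              (mul_le_mul_of_nonneg_left hw hs0)
        _ = C := by ring
    · simpa using ih x a

lemma abs_critic_succ_sub_le (hr : ∀ x a, 0 ≤ r x a ∧ r x a ≤ 1) (hγ : 0 < γ ∧ γ < 1)
    (hα : 0 < α) (hg : ∀ k, IsPolicy (g k)) (hC : 1 + γ * C ≤ C)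
    (hQC : ∀ k x a, |Q k x a| ≤ C)
    (hQ : ∀ k x a, Q (k + 1) x a = Q k x a + (α / N) *
      (r (y k) (b k) + γ * (∑ a'', Q k (y (k + 1)) a'' * g k (y (k + 1)) a'') - Q k (y k) (b k)) *
      (if y k = x ∧ b k = a then 1 else 0)) (k : ℕ) (x : X) (a : A) :
    |Q (k + 1) x a - Q k x a| ≤ 2 * α * C / N := by
  have hC0 : 0 ≤ C := (abs_nonneg _).trans (hQC k x a)
  rw [hQ, add_sub_cancel_left]
  set u := ∑ a'', Q k (y (k + 1)) a'' * g k (y (k + 1)) a'' with hu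
  have hub : |u| ≤ C := abs_sum_mul_policy_le (hg k) (hQC k) _
  have hw : |r (y k) (b k) + γ * u| ≤ C := by
    refine (abs_add_le _ _).trans (le_trans (add_le_add ?_ ?_) hC)
    · rw [abs_of_nonneg (hr _ _).1]; exact (hr _ _).2
    · rw [abs_mul, abs_of_pos hγ.1]
      exact mul_le_mul_of_nonneg_left hub hγ.1.le
  have h2 : |r (y k) (b k) + γ * u - Q k (y k) (b k)| ≤ 2 * C := by
    refine (abs_sub _ _).trans ?_
    linarith [hQC k (y k) (b k)]
  have h3 : |(if y k = x ∧ b k = a then 1 else 0 : ℝ)| ≤ 1 := by split_ifs <;> simp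
  rw [abs_mul, abs_mul, abs_of_nonneg (by positivity : 0 ≤ α / N)]
  calc _ ≤ α / N * (2 * C) * 1 := by gcongr
    _ = _ := by ring

lemma abs_actor_succ_sub_le [Nonempty A] (hQC : ∀ k x a, |Q k x a| ≤ C)
    (hθ : ∀ k x a, θ (k + 1) x a = θ k x a + (zetaN N k / N) *
      Q k (y' k) (b' k) * (if y' k = x then 1 else 0) *
      ((if b' k = a then 1 else 0) - softmaxPol (θ k) (y' k) a)) (k : ℕ) (x : X) (a : A) :
    |θ (k + 1) x a - θ k x a| ≤ C / N := by
  have hC0 : 0 ≤ C := (abs_nonneg _).trans (hQC k x a)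
  rw [hθ, add_sub_cancel_left]
  have h1 : |(if y' k = x then 1 else 0 : ℝ)| ≤ 1 := by split_ifs <;> simp
  have h2 : |(if b' k = a then 1 else 0 : ℝ) - softmaxPol (θ k) (y' k) a| ≤ 1 := by
    have h3 := (isPolicy_softmaxPol (θ k)).1 (y' k) a
    have h4 := (isPolicy_softmaxPol (θ k)).le_one (y' k) a
    split_ifs <;> exact abs_le.2 ⟨by linarith, by linarith⟩
  have h5 := zetaN_mem N k
  have h6 : |zetaN N k / N| ≤ 1 / N := by
    rw [abs_of_nonneg (div_nonneg h5.1 (Nat.cast_nonneg _))]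
    gcongr
    exact h5.2
  rw [abs_mul, abs_mul, abs_mul]
  calc _ ≤ 1 / (N : ℝ) * C * 1 * 1 := by
        gcongr
        exact hQC _ _ _
    _ = _ := by ring

end CriticIterates

section Adapted

variable {X A : Type*} [Fintype X] [Fintype A] [DecidableEq X] [DecidableEq A]
  [MeasurableSpace X] [MeasurableSingletonClass X] [MeasurableSpace A] [MeasurableSingletonClass A]
  {Ω : Type*} {mΩ : MeasurableSpace Ω} {ℱ : Filtration ℕ mΩ} {r : X → A → ℝ} {γ α : ℝ} {N : ℕ}
  {xc xa : ℕ → Ω → X} {ac aa : ℕ → Ω → A} {Q θ : ℕ → Ω → X → A → ℝ} {Q0 θ0 : X → A → ℝ}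

lemma measurable_actor_succ {m : MeasurableSpace Ω} {k : ℕ}
    (hm : Measurable fun ω => (xa k ω, aa k ω))
    (hQ : ∀ x a, Measurable fun ω => Q k ω x a) (hθk : ∀ x a, Measurable fun ω => θ k ω x a)
    (hθ : ∀ ω x a, θ (k + 1) ω x a = θ k ω x a + (zetaN N k / N) *
      Q k ω (xa k ω) (aa k ω) * (if xa k ω = x then 1 else 0) *
      ((if aa k ω = a then 1 else 0) - softmaxPol (θ k ω) (xa k ω) a)) (x : X) (a : A) :
    Measurable fun ω => θ (k + 1) ω x a := by
  have h1 : Measurable fun ω => Q k ω (xa k ω) (aa k ω) :=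
    measurable_apply_finite (f := fun ω (s : X × A) => Q k ω s.1 s.2)
      (fun s => hQ s.1 s.2) hm
  have h2 : Measurable fun ω => softmaxPol (θ k ω) (xa k ω) a :=
    measurable_apply_finite (f := fun ω (s : X) => softmaxPol (θ k ω) s a)
      (fun s => measurable_softmaxPol hθk s a) (measurable_fst.comp hm)
  have h3 : Measurable fun ω => if xa k ω = x then (1 : ℝ) else 0 :=
    Measurable.ite ((measurable_fst.comp hm) (measurableSet_singleton x)) measurable_const
      measurable_const
  have h4 : Measurable fun ω => if aa k ω = a then (1 : ℝ) else 0 :=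
    Measurable.ite ((measurable_snd.comp hm) (measurableSet_singleton a)) measurable_const
      measurable_const
  simp only [hθ]
  exact (hθk x a).add (((h1.const_mul _).mul h3).mul (h4.sub h2))

lemma measurable_critic_succ {m : MeasurableSpace Ω} {k : ℕ}
    (hm : Measurable fun ω => (xc k ω, ac k ω))
    (hm' : Measurable fun ω => (xc (k + 1) ω, ac (k + 1) ω))
    (hQk : ∀ x a, Measurable fun ω => Q k ω x a) (hθk : ∀ x a, Measurable fun ω => θ k ω x a)
    (hQ : ∀ ω x a, Q (k + 1) ω x a = Q k ω x a + (α / N) *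
      (r (xc k ω) (ac k ω) + γ * (∑ a'', Q k ω (xc (k + 1) ω) a'' *
          explorePol (etaN N k) (θ k ω) (xc (k + 1) ω) a'')
        - Q k ω (xc k ω) (ac k ω)) *
      (if xc k ω = x ∧ ac k ω = a then 1 else 0)) (x : X) (a : A) :
    Measurable fun ω => Q (k + 1) ω x a := by
  have h1 : Measurable fun ω => Q k ω (xc k ω) (ac k ω) :=
    measurable_apply_finite (f := fun ω (s : X × A) => Q k ω s.1 s.2)
      (fun s => hQk s.1 s.2) hm
  have h2 : Measurable fun ω => r (xc k ω) (ac k ω) :=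
    measurable_apply_finite (f := fun _ (s : X × A) => r s.1 s.2)
      (fun s => measurable_const) hm
  have h3 : Measurable fun ω => ∑ a'', Q k ω (xc (k + 1) ω) a'' *
      explorePol (etaN N k) (θ k ω) (xc (k + 1) ω) a'' :=
    measurable_apply_finite (f := fun ω (s : X) => ∑ a'', Q k ω s a'' *
        explorePol (etaN N k) (θ k ω) s a'')
      (fun s => Finset.measurable_sum _ fun a'' _ =>
        (hQk s a'').mul (measurable_explorePol hθk _ s a'')) (measurable_fst.comp hm')
  have h4 : Measurable fun ω => if xc k ω = x ∧ ac k ω = a then (1 : ℝ) else 0 :=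
    Measurable.ite (((measurable_fst.comp hm) (measurableSet_singleton x)).inter
      ((measurable_snd.comp hm) (measurableSet_singleton a))) measurable_const measurable_const
  simp only [hQ]
  exact (hQk x a).add (((h2.add (h3.const_mul γ)).sub h1).const_mul _ |>.mul h4)

lemma measurable_actor_critic
    (hQinit : ∀ ω, Q 0 ω = Q0) (hθinit : ∀ ω, θ 0 ω = θ0)
    (hQ : ∀ k ω x a, Q (k + 1) ω x a = Q k ω x a + (α / N) *
      (r (xc k ω) (ac k ω) + γ * (∑ a'', Q k ω (xc (k + 1) ω) a'' *
          explorePol (etaN N k) (θ k ω) (xc (k + 1) ω) a'')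
        - Q k ω (xc k ω) (ac k ω)) *
      (if xc k ω = x ∧ ac k ω = a then 1 else 0))
    (hθ : ∀ k ω x a, θ (k + 1) ω x a = θ k ω x a + (zetaN N k / N) *
      Q k ω (xa k ω) (aa k ω) * (if xa k ω = x then 1 else 0) *
      ((if aa k ω = a then 1 else 0) - softmaxPol (θ k ω) (xa k ω) a))
    (hc : ∀ k, Measurable[ℱ k] fun ω => (xc k ω, ac k ω))
    (ha : ∀ k, Measurable[ℱ k] fun ω => (xa k ω, aa k ω)) (k : ℕ) :
    (∀ x a, Measurable[ℱ k] fun ω => Q k ω x a) ∧ (∀ x a, Measurable[ℱ k] fun ω => θ k ω x a) ∧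
      ∀ x a, Measurable[ℱ k] fun ω => θ (k + 1) ω x a := by
  have key : (∀ x a, Measurable[ℱ k] fun ω => Q k ω x a) ∧
      ∀ x a, Measurable[ℱ k] fun ω => θ k ω x a := by
    induction k with
    | zero =>
      simp only [hQinit, hθinit]
      exact ⟨fun _ _ => measurable_const, fun _ _ => measurable_const⟩
    | succ k ih =>
      have hle : ℱ k ≤ ℱ (k + 1) := ℱ.mono (Nat.le_succ k)
      have hQk : ∀ x a, Measurable[ℱ (k + 1)] fun ω => Q k ω x a :=
        fun x a => (ih.1 x a).mono hle le_rfl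
      have hθk : ∀ x a, Measurable[ℱ (k + 1)] fun ω => θ k ω x a :=
        fun x a => (ih.2 x a).mono hle le_rfl
      exact ⟨measurable_critic_succ (m := ℱ (k + 1)) ((hc k).mono hle le_rfl) (hc (k + 1)) hQk hθk
          (hQ k),
        measurable_actor_succ (m := ℱ (k + 1)) ((ha k).mono hle le_rfl) hQk hθk (hθ k)⟩
  exact ⟨key.1, key.2, measurable_actor_succ (m := ℱ k) (ha k) key.1 key.2 (hθ k)⟩

end Adapted

theorem critic_fluctuation_processes_vanish
    {X A : Type*} [Fintype X] [Fintype A] [Nonempty X] [Nonempty A]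
    [DecidableEq X] [DecidableEq A]
    (p : X → A → X → ℝ) (μ : X → ℝ) (r : X → A → ℝ) (γ α : ℝ)
    (hp0 : ∀ x a x', 0 ≤ p x a x') (hp1 : ∀ x a, ∑ x', p x a x' = 1)
    (hμ0 : ∀ x, 0 ≤ μ x) (hμ1 : ∑ x, μ x = 1)
    (hr : ∀ x a, 0 ≤ r x a ∧ r x a ≤ 1) (hγ : 0 < γ ∧ γ < 1) (hα : 0 < α)
    (sigsta : (X → A → ℝ) → X × A → ℝ)
    (hsig : ∀ θ : X → A → ℝ,
      IsStationaryDist (actorKer γ p μ (softmaxPol θ)) (sigsta (softmaxPol θ)))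
    (hsigLip : ∃ L : ℝ, ∀ f f' : X → A → ℝ,
      ∑ ξ : X × A, |sigsta f ξ - sigsta f' ξ| ≤ L * ∑ x, ∑ a, |f x a - f' x a|)
    (hergA : ∀ θ : X → A → ℝ, ∃ n, 0 < n ∧
      ∀ ξ ξ' : X × A, 0 < kpow (actorKer γ p μ (softmaxPol θ)) n ξ ξ')
    (pista : (X → A → ℝ) → X × A → ℝ)
    (hpi : ∀ (η : ℝ) (θ : X → A → ℝ), 0 ≤ η → η < 1 →
      IsStationaryDist (criticKer p (explorePol η θ)) (pista (explorePol η θ)))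
    (hpiLip : ∃ L : ℝ, ∀ f f' : X → A → ℝ,
      ∑ ξ : X × A, |pista f ξ - pista f' ξ| ≤ L * ∑ x, ∑ a, |f x a - f' x a|)
    (hergC : ∀ (η : ℝ) (θ : X → A → ℝ), 0 ≤ η → η < 1 → ∃ n, 0 < n ∧
      ∀ ξ ξ' : X × A, 0 < kpow (criticKer p (explorePol η θ)) n ξ ξ')
    {Ω : Type*} [mΩ : MeasurableSpace Ω] (P : Measure Ω) [IsProbabilityMeasure P]
    [MeasurableSpace X] [MeasurableSingletonClass X]
    [MeasurableSpace A] [MeasurableSingletonClass A]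
    (Q0 θ0 : X → A → ℝ)
    (F : ℕ → MeasureTheory.Filtration ℕ mΩ)
    (xc : ℕ → ℕ → Ω → X) (ac : ℕ → ℕ → Ω → A)
    (xa : ℕ → ℕ → Ω → X) (aa : ℕ → ℕ → Ω → A)
    (Q θ : ℕ → ℕ → Ω → X → A → ℝ)
    (hQinit : ∀ N ω, Q N 0 ω = Q0) (hθinit : ∀ N ω, θ N 0 ω = θ0)
    (hQrec : ∀ N k ω x a, Q N (k + 1) ω x a = Q N k ω x a + (α / N) *
      (r (xc N k ω) (ac N k ω) + γ * (∑ a'', Q N k ω (xc N (k + 1) ω) a'' *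
          explorePol (etaN N k) (θ N k ω) (xc N (k + 1) ω) a'')
        - Q N k ω (xc N k ω) (ac N k ω)) *
      (if xc N k ω = x ∧ ac N k ω = a then 1 else 0))
    (hθrec : ∀ N k ω x a, θ N (k + 1) ω x a = θ N k ω x a + (zetaN N k / N) *
      Q N k ω (xa N k ω) (aa N k ω) * (if xa N k ω = x then 1 else 0) *
      ((if aa N k ω = a then 1 else 0) - softmaxPol (θ N k ω) (xa N k ω) a))
    (hadaptc : ∀ N k, Measurable[(F N) k] fun ω => (xc N k ω, ac N k ω))
    (hadapta : ∀ N k, Measurable[(F N) k] fun ω => (xa N k ω, aa N k ω))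
    (hMarkovC : ∀ N k (ξ' : X × A),
      (P[(fun ω => if (xc N (k + 1) ω, ac N (k + 1) ω) = ξ' then (1 : ℝ) else 0)|(F N) k])
        =ᵐ[P] fun ω => p (xc N k ω) (ac N k ω) ξ'.1 *
          explorePol (etaN N (k + 1)) (θ N (k + 1) ω) ξ'.1 ξ'.2)
    (hMarkovA : ∀ N k (ξ' : X × A),
      (P[(fun ω => if (xa N (k + 1) ω, aa N (k + 1) ω) = ξ' then (1 : ℝ) else 0)|(F N) k])
        =ᵐ[P] fun ω => ptilde γ p μ (xa N k ω) (aa N k ω) ξ'.1 *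
          softmaxPol (θ N (k + 1) ω) ξ'.1 ξ'.2)
    (x : X) (a : A) (T : ℝ) (hT : 0 < T) :
    (Tendsto (fun N : ℕ => ⨆ t : Set.Ioc (0 : ℝ) T, ∫ ω,
        |-(1 / (N : ℝ)) * (∑ k ∈ Finset.range ⌊(N : ℝ) * (t : ℝ)⌋₊,
              Q N k ω (xc N k ω) (ac N k ω) *
                (if (xc N k ω, ac N k ω) = (x, a) then (1 : ℝ) else 0)) +
          (1 / (N : ℝ)) * ∑ k ∈ Finset.range ⌊(N : ℝ) * (t : ℝ)⌋₊,
            ∑ ξ' : X × A, Q N k ω ξ'.1 ξ'.2 * (if ξ' = (x, a) then (1 : ℝ) else 0) *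
              pista (explorePol (etaN N k) (θ N k ω)) ξ'| ∂P)
      atTop (nhds 0)) ∧
    (Tendsto (fun N : ℕ => ⨆ t : Set.Ioc (0 : ℝ) T, ∫ ω,
        |(1 / (N : ℝ)) * (∑ k ∈ Finset.range ⌊(N : ℝ) * (t : ℝ)⌋₊,
              r (xc N k ω) (ac N k ω) *
                (if (xc N k ω, ac N k ω) = (x, a) then (1 : ℝ) else 0)) -
          (1 / (N : ℝ)) * ∑ k ∈ Finset.range ⌊(N : ℝ) * (t : ℝ)⌋₊,
            ∑ ξ' : X × A, r ξ'.1 ξ'.2 * (if ξ' = (x, a) then (1 : ℝ) else 0) *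
              pista (explorePol (etaN N k) (θ N k ω)) ξ'| ∂P)
      atTop (nhds 0)) ∧
    (Tendsto (fun N : ℕ => ⨆ t : Set.Ioc (0 : ℝ) T, ∫ ω,
        |(1 / (N : ℝ)) * (∑ k ∈ Finset.range ⌊(N : ℝ) * (t : ℝ)⌋₊,
              γ * (∑ a'', Q N k ω (xc N (k + 1) ω) a'' *
                  explorePol (etaN N k) (θ N k ω) (xc N (k + 1) ω) a'') *
                (if (xc N k ω, ac N k ω) = (x, a) then (1 : ℝ) else 0)) -
          (1 / (N : ℝ)) * ∑ k ∈ Finset.range ⌊(N : ℝ) * (t : ℝ)⌋₊,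
            ∑ ξ' : X × A, (∑ z, ∑ a'', γ * Q N k ω z a'' *
                explorePol (etaN N k) (θ N k ω) z a'' * p ξ'.1 ξ'.2 z) *
              (if ξ' = (x, a) then (1 : ℝ) else 0) *
              pista (explorePol (etaN N k) (θ N k ω)) ξ'| ∂P)
      atTop (nhds 0)) := by
  have hpol : ∀ N k (ϑ : X → A → ℝ), IsPolicy (explorePol (etaN N k) ϑ) := fun N k ϑ =>
    isPolicy_explorePol (etaN_mem N k).1 (etaN_mem N k).2 ϑ
  have hstat : ∀ N k (ϑ : X → A → ℝ), IsStationaryDist (criticKer p (explorePol (etaN N k) ϑ))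
      (pista (explorePol (etaN N k) ϑ)) := by
    intro N k ϑ
    rcases (etaN_mem N k).2.lt_or_eq with h | h
    · exact hpi _ _ (etaN_mem N k).1 h
    · rw [h, explorePol_one_eq]
      exact hpi _ _ le_rfl zero_lt_one
  obtain ⟨N₁, hN₁⟩ := exists_nat_ge (max α 1)
  have hpos : ∀ N ≥ N₁, 0 < N ∧ α ≤ N := by
    intro N hN
    have h : max α 1 ≤ (N : ℝ) := hN₁.trans (by exact_mod_cast hN)
    exact ⟨by exact_mod_cast zero_lt_one.trans_le ((le_max_right _ _).trans h),
      (le_max_left _ _).trans h⟩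
  have habs : ∀ (q : X → A → ℝ) x a, |q x a| ≤ ∑ x, ∑ a, |q x a| := fun q x a =>
    (Finset.single_le_sum (f := fun a => |q x a|) (fun _ _ => abs_nonneg _)
      (Finset.mem_univ a)).trans (Finset.single_le_sum (f := fun x => ∑ a, |q x a|)
        (fun _ _ => Finset.sum_nonneg fun _ _ => abs_nonneg _) (Finset.mem_univ x))
  have hγ1 : 0 < 1 - γ := by linarith [hγ.2]
  set c : ℝ := ∑ x, ∑ a, |Q0 x a| + 1 / (1 - γ) with hc
  have hs0 : 0 ≤ ∑ x, ∑ a, |Q0 x a| :=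
    Finset.sum_nonneg fun _ _ => Finset.sum_nonneg fun _ _ => abs_nonneg _
  have hinv : 0 < 1 / (1 - γ) := by positivity
  have hc0 : 0 ≤ c := by positivity
  have hcγ : 1 + γ * c ≤ c := by
    have h1 : 1 / (1 - γ) * (1 - γ) = 1 := by field_simp
    have h2 : 1 / (1 - γ) * (1 - γ) ≤ c * (1 - γ) :=
      mul_le_mul_of_nonneg_right (by linarith) hγ1.le
    linarith
  have hQb : ∀ N ≥ N₁, ∀ ω k x a, |Q N k ω x a| ≤ c := fun N hN ω =>
    abs_critic_le (Q := fun k => Q N k ω) (g := fun k => explorePol (etaN N k) (θ N k ω))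
      hr hγ hα (hpos N hN).1 (hpos N hN).2 (fun k => hpol N k _)
      (fun x a => by simp only [hQinit]; linarith [habs Q0 x a]) hcγ (fun k => hQrec N k ω)
  have hQs : ∀ N ≥ N₁, ∀ ω k x a, |Q N (k + 1) ω x a - Q N k ω x a| ≤ 2 * α * c / N :=
    fun N hN ω => abs_critic_succ_sub_le (Q := fun k => Q N k ω)
      (g := fun k => explorePol (etaN N k) (θ N k ω)) hr hγ hα (fun k => hpol N k _) hcγ
      (hQb N hN ω) (fun k => hQrec N k ω)
  have hθs : ∀ N ≥ N₁, ∀ ω k x a, |θ N (k + 1) ω x a - θ N k ω x a| ≤ c / N :=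
    fun N hN ω => abs_actor_succ_sub_le (Q := fun k => Q N k ω) (θ := fun k => θ N k ω)
      (hQb N hN ω) (fun k => hθrec N k ω)
  have hgs : ∀ N ≥ N₁, ∀ ω k x a, |explorePol (etaN N (k + 1)) (θ N (k + 1) ω) x a -
      explorePol (etaN N k) (θ N k ω) x a| ≤ (1 + 2 * c) / N := by
    intro N hN ω k x a
    refine (abs_explorePol_sub_le (etaN_mem N k).1 (etaN_mem N k).2
      (abs_etaN_succ_sub_le (hpos N hN).1 k) (hθs N hN ω k) x a).trans_eq (by ring)
  have hmeas := fun N k => measurable_actor_critic (ℱ := F N) (hQinit N) (hθinit N) (hQrec N)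
    (hθrec N) (hadaptc N) (hadapta N) k
  set B : ℝ := ∑ x, ∑ a, |θ0 x a| + T * c with hB
  have hB0 : 0 ≤ B := add_nonneg
    (Finset.sum_nonneg fun _ _ => Finset.sum_nonneg fun _ _ => abs_nonneg _) (by positivity)
  obtain ⟨n₀, -, hn₀⟩ := hergC 0 0 le_rfl zero_lt_one
  obtain ⟨β, hβ0, hβ1, hβ⟩ := exists_doeblin_criticKer hp0 hp1 hn₀ hB0
  set C : ℝ := 1 + c + 2 * α * c + Fintype.card A * (1 + 2 * c) +
    Fintype.card A * (c * (1 + 2 * c)) with hC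
  have hC0 : 0 ≤ C := by positivity
  have hcC : c ≤ C := by
    have : 0 ≤ 2 * α * c + Fintype.card A * (1 + 2 * c) + Fintype.card A * (c * (1 + 2 * c)) := by
      positivity
    linarith
  have h1C : 1 ≤ C := by
    have : 0 ≤ c + 2 * α * c + Fintype.card A * (1 + 2 * c) +
      Fintype.card A * (c * (1 + 2 * c)) := by positivity
    linarith
  have hαC : 2 * α * c + Fintype.card A * (c * (1 + 2 * c)) ≤ C := by
    have : 0 ≤ 1 + c + Fintype.card A * (1 + 2 * c) := by positivity
    linarith
  have hαC' : 2 * α * c ≤ C := by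
    have : 0 ≤ Fintype.card A * (c * (1 + 2 * c)) := by positivity
    linarith
  have hgC : Fintype.card A * (1 + 2 * c) ≤ C := by
    have : 0 ≤ 1 + c + 2 * α * c + Fintype.card A * (c * (1 + 2 * c)) := by positivity
    linarith
  set K : ℕ → ℕ → Ω → X × A → X × A → ℝ := fun N k ω =>
    criticKer p (explorePol (etaN N k) (θ N k ω)) with hK
  have chain : ∀ h V : ℕ → ℕ → Ω → X × A → ℝ, ∀ N ≥ N₁,
      (∀ k s, Measurable[F N k] fun ω => h N k ω s) →
      (∀ k s, Measurable[F N k] fun ω => V N k ω s) →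
      (∀ k ω s, |h N k ω s| ≤ C) → (∀ k ω s, |V N k ω s| ≤ C) →
      (∀ k ω s, |h N (k + 1) ω s - h N k ω s| ≤ C / N) → ∀ n : ℕ, (n : ℝ) ≤ N * T →
      SlowChain P (F N) (fun k ω => (xc N k ω, ac N k ω)) (K N)
        (fun k ω => pista (explorePol (etaN N k) (θ N k ω))) (h N) (V N) C β n₀ N n := by
    intro h V N hN hhm hVm hhb hVb hhs n hn
    have hN' : (0 : ℝ) < N := by exact_mod_cast (hpos N hN).1
    refine ⟨hadaptc N, fun k ω => isStochastic_criticKer hp0 hp1 (hpol N k _), fun k s s' => ?_,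
      fun k s s' => ?_, hhm, hVm, hhb, hVb, hhs, fun k ω s => ?_, hMarkovC N,
      fun k ω => hstat N k _, fun k hk ω => ?_⟩
    · exact (measurable_explorePol (m := F N k) (hmeas N k).2.1 _ _ _).const_mul _
    · exact (measurable_explorePol (m := F N k) (hmeas N k).2.2 _ _ _).const_mul _
    · refine (sum_abs_criticKer_sub_le hp0 hp1 (hgs N hN ω k) s).trans ?_
      rw [← mul_div_assoc]
      gcongr
    · refine hβ _ _ (etaN_mem N k).1 (etaN_mem N k).2 fun x a => ?_
      refine (abs_actor_le (θ := fun k => θ N k ω) (B := ∑ x, ∑ a, |θ0 x a|)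
        (fun x a => by simp only [hθinit]; exact habs θ0 x a) (hθs N hN ω) k x a).trans ?_
      have h1 : (k : ℝ) ≤ N * T := le_trans (by exact_mod_cast hk.le) hn
      have h2 : (k : ℝ) * (c / N) ≤ N * T * (c / N) :=
        mul_le_mul_of_nonneg_right h1 (by positivity)
      have h3 : N * T * (c / N) = T * c := by field_simp
      linarith
  have average : ∀ h V : ℕ → ℕ → Ω → X × A → ℝ,
      (∀ N k s, Measurable[F N k] fun ω => h N k ω s) →
      (∀ N k s, Measurable[F N k] fun ω => V N k ω s) →
      (∀ N ≥ N₁, ∀ k ω s, |h N k ω s| ≤ C) → (∀ N ≥ N₁, ∀ k ω s, |V N k ω s| ≤ C) →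
      (∀ N ≥ N₁, ∀ k ω s, |h N (k + 1) ω s - h N k ω s| ≤ C / N) →
      Tendsto (fun N : ℕ => ⨆ t : Set.Ioc (0 : ℝ) T, ∫ ω, |1 / (N : ℝ) *
        ∑ k ∈ Finset.range ⌊(N : ℝ) * (t : ℝ)⌋₊, (h N k ω (xc N k ω, ac N k ω) -
          ∑ s, pista (explorePol (etaN N k) (θ N k ω)) s * h N k ω s +
          (V N k ω (xc N (k + 1) ω, ac N (k + 1) ω) -
            kernelApp (K N (k + 1) ω) (V N k ω) (xc N k ω, ac N k ω)))| ∂P) atTop (nhds 0) :=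
    fun h V hhm hVm hhb hVb hhs => SlowChain.tendsto_iSup_integral hC0 hβ0 hβ1 hT
      fun N hN => chain h V N hN (hhm N) (hVm N) (hhb N hN) (hVb N hN) (hhs N hN)
  have hind : ∀ (q : Prop) [Decidable q] (u b : ℝ), |u| ≤ b →
      |u * (if q then (1 : ℝ) else 0)| ≤ b := by
    intro q _ u b hu
    split_ifs
    · simpa using hu
    · simpa using (abs_nonneg u).trans hu
  have hu_bdd : ∀ N ≥ N₁, ∀ k ω z, |γ * ∑ a'', Q N k ω z a'' *
      explorePol (etaN N k) (θ N k ω) z a''| ≤ C := by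
    intro N hN k ω z
    have h1 := abs_sum_mul_policy_le (hpol N k (θ N k ω)) (hQb N hN ω k) z
    rw [abs_mul, abs_of_pos hγ.1]
    exact (mul_le_of_le_one_left (abs_nonneg _) hγ.2.le).trans (h1.trans hcC)
  have hu_slow : ∀ N ≥ N₁, ∀ k ω z, |γ * (∑ a'', Q N (k + 1) ω z a'' *
      explorePol (etaN N (k + 1)) (θ N (k + 1) ω) z a'') - γ * ∑ a'', Q N k ω z a'' *
      explorePol (etaN N k) (θ N k ω) z a''| ≤ C / N := by
    intro N hN k ω z
    have h1 := abs_sum_mul_policy_sub_le (hpol N (k + 1) (θ N (k + 1) ω)) (hQb N hN ω k)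
      (hQs N hN ω k) (hgs N hN ω k) z
    rw [← mul_sub, abs_mul, abs_of_pos hγ.1]
    refine (mul_le_of_le_one_left (abs_nonneg _) hγ.2.le).trans (h1.trans ?_)
    have h2 : 2 * α * c / N + Fintype.card A * (c * ((1 + 2 * c) / N)) =
      (2 * α * c + Fintype.card A * (c * (1 + 2 * c))) / N := by ring
    rw [h2]
    gcongr
  have hu_meas : ∀ N k z, Measurable[F N k] fun ω => γ * ∑ a'', Q N k ω z a'' *
      explorePol (etaN N k) (θ N k ω) z a'' := by
    intro N k z
    refine Measurable.const_mul (Finset.measurable_sum _ fun a'' _ => ?_) γ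
    exact ((hmeas N k).1 z a'').mul (measurable_explorePol (m := F N k) (hmeas N k).2.1 _ _ _)
  have hw : ∀ N k ω (s : X × A), ∑ z, ∑ a'', γ * Q N k ω z a'' *
      explorePol (etaN N k) (θ N k ω) z a'' * p s.1 s.2 z =
      ∑ z, p s.1 s.2 z * (γ * ∑ a'', Q N k ω z a'' *
      explorePol (etaN N k) (θ N k ω) z a'') := by
    intro N k ω s
    refine Finset.sum_congr rfl fun z _ => ?_
    simp only [Finset.mul_sum]
    exact Finset.sum_congr rfl fun a'' _ => by ring
  refine ⟨?_, ?_, ?_⟩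
  · refine (average
      (fun N k ω s => -(Q N k ω s.1 s.2 * if s = (x, a) then (1 : ℝ) else 0))
      (fun _ _ _ _ => 0)
      (fun N k s => ?_) (fun _ _ _ => measurable_const) (fun N hN k ω s => ?_)
      (fun _ _ _ _ _ => by simpa using hC0) (fun N hN k ω s => ?_)).congr
      fun N => iSup_congr fun t => ?_
    · exact (((hmeas N k).1 s.1 s.2).mul_const _).neg
    · rw [abs_neg]
      exact hind _ _ _ ((hQb N hN ω k _ _).trans hcC)
    · rw [neg_sub_neg, ← sub_mul]
      refine hind _ _ _ ?_
      rw [abs_sub_comm]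
      exact (hQs N hN ω k _ _).trans (by gcongr)
    · refine integral_congr_ae (Eventually.of_forall fun ω => ?_)
      simp only [neg_mul, ← mul_neg, ← mul_add, ← Finset.sum_neg_distrib,
        ← Finset.sum_add_distrib]
      congr 2
      refine Finset.sum_congr rfl fun k _ => ?_
      simp [kernelApp, mul_comm]
  · refine (average
      (fun N k ω s => r s.1 s.2 * if s = (x, a) then (1 : ℝ) else 0)
      (fun _ _ _ _ => 0)
      (fun _ _ _ => measurable_const) (fun _ _ _ => measurable_const)
      (fun N hN k ω s => ?_) (fun _ _ _ _ _ => by simpa using hC0)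
      (fun N hN k ω s => ?_)).congr fun N => iSup_congr fun t => ?_
    · refine hind _ _ _ ?_
      rw [abs_of_nonneg (hr _ _).1]
      exact (hr _ _).2.trans h1C
    · rw [sub_self, abs_zero]
      positivity
    · refine integral_congr_ae (Eventually.of_forall fun ω => ?_)
      simp only [← mul_sub, ← Finset.sum_sub_distrib]
      congr 2
      refine Finset.sum_congr rfl fun k _ => ?_
      simp [kernelApp, mul_comm]
  · refine (average
      (fun N k ω s => (∑ z, ∑ a'', γ * Q N k ω z a'' *
        explorePol (etaN N k) (θ N k ω) z a'' * p s.1 s.2 z) *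
        if s = (x, a) then (1 : ℝ) else 0)
      (fun N k ω s => (γ * ∑ a'', Q N k ω s.1 a'' *
        explorePol (etaN N k) (θ N k ω) s.1 a'') *
        if (xc N k ω, ac N k ω) = (x, a) then (1 : ℝ) else 0)
      (fun N k s => ?_) (fun N k s => ?_) (fun N hN k ω s => ?_)
      (fun N hN k ω s => ?_) (fun N hN k ω s => ?_)).congr fun N => iSup_congr fun t => ?_
    · simp only [hw]
      exact (Finset.measurable_sum _ fun z _ => (hu_meas N k z).const_mul _).mul_const _
    · exact (hu_meas N k s.1).mul (Measurable.ite
        (hadaptc N k (measurableSet_singleton (x, a))) measurable_const measurable_const)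
    · rw [hw]
      exact hind _ _ _ (abs_sum_mul_le_of_sum_eq_one (hp0 _ _) (hp1 _ _) (hu_bdd N hN k ω))
    · exact hind _ _ _ (hu_bdd N hN k ω _)
    · rw [hw, hw, ← sub_mul, ← Finset.sum_sub_distrib]
      refine hind _ _ _ ?_
      simp only [← mul_sub]
      refine abs_sum_mul_le_of_sum_eq_one (hp0 _ _) (hp1 _ _) fun z => ?_
      rw [mul_sub]
      exact hu_slow N hN k ω z
    · refine integral_congr_ae (Eventually.of_forall fun ω => ?_)
      simp only [← mul_sub, ← Finset.sum_sub_distrib]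
      congr 2
      refine Finset.sum_congr rfl fun k _ => ?_
      have hk := kernelApp_criticKer_fst (p := p) (hpol N (k + 1) (θ N (k + 1) ω))
        (fun z => (γ * ∑ a'', Q N k ω z a'' * explorePol (etaN N k) (θ N k ω) z a'') *
          if (xc N k ω, ac N k ω) = (x, a) then (1 : ℝ) else 0) (xc N k ω, ac N k ω)
      have hh := hw N k ω (xc N k ω, ac N k ω)
      simp only [hK]
      rw [hk, hh, Finset.sum_mul]
      simp only [mul_comm (pista _ _), mul_assoc]
      ring
end
end

section
/- Uniform bound for the limit critic: if the limit ODE is initialized with Q̄_0 = 0, then max_{(x,a)} |Q̄_t(x,a)| ≤ 2/(1−γ) for all t ≥ 0. -/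
open MeasureTheory Filter Set
open scoped Classical

noncomputable section

open scoped Topology

/-- A finite family of differentiable functions that starts below a differentiable barrier stays
below it, if no member can touch the barrier with a slope at least that of the barrier. -/
theorem forall_lt_of_hasDerivAt_lt_barrier {ι : Type*} [Finite ι]
    {u u' : ι → ℝ → ℝ} {b b' : ℝ → ℝ}
    (hu : ∀ i t, 0 ≤ t → HasDerivAt (u i) (u' i t) t)
    (hb : ∀ t, 0 ≤ t → HasDerivAt b (b' t) t)
    (h0 : ∀ i, u i 0 < b 0)
    (hlt : ∀ i t, 0 < t → u i t = b t → (∀ j, u j t ≤ b t) → u' i t < b' t)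
    (i : ι) (t : ℝ) (ht : 0 ≤ t) : u i t < b t := by
  by_contra! hi
  have hcu : ∀ j, ContinuousOn (u j) (Icc 0 t) := fun j s hs =>
    (hu j s hs.1).continuousAt.continuousWithinAt
  have hcb : ContinuousOn b (Icc 0 t) := fun s hs => (hb s hs.1).continuousAt.continuousWithinAt
  have hcomp : IsCompact (⋃ j, {s ∈ Icc 0 t | b s ≤ u j s}) :=
    isCompact_iUnion fun j => isCompact_Icc.of_isClosed_subset
      (isClosed_Icc.isClosed_le hcb (hcu j)) (sep_subset _ _)
  obtain ⟨τ, hτ, hmin⟩ := hcomp.exists_isLeast ⟨t, mem_iUnion.2 ⟨i, ⟨ht, le_rfl⟩, hi⟩⟩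
  obtain ⟨j, ⟨hτ0, hτt⟩, hj⟩ := mem_iUnion.1 hτ
  have hτpos : 0 < τ := hτ0.lt_of_ne (by rintro rfl; exact (h0 j).not_ge hj)
  have hbefore : ∀ k s, 0 ≤ s → s < τ → u k s < b s := fun k s hs hsτ => by
    by_contra! hk
    exact hsτ.not_ge (hmin (mem_iUnion.2 ⟨k, ⟨hs, hsτ.le.trans hτt⟩, hk⟩))
  have hmem : ∀ᶠ s in 𝓝[<] τ, s ∈ Ioo 0 τ := Ioo_mem_nhdsLT hτpos
  have hle : ∀ k, u k τ ≤ b τ := fun k =>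
    le_of_tendsto_of_tendsto ((hu k τ hτ0).continuousAt.continuousWithinAt (s := Iio τ))
      ((hb τ hτ0).continuousAt.continuousWithinAt (s := Iio τ))
      (hmem.mono fun s hs => (hbefore k s hs.1.le hs.2).le)
  have heq : u j τ = b τ := (hle j).antisymm hj
  have hslope := (hasDerivAt_iff_tendsto_slope.1 ((hu j τ hτ0).sub (hb τ hτ0))).mono_left
    (nhdsWithin_mono τ (show Iio τ ⊆ {τ}ᶜ from fun s (hs : s < τ) => hs.ne))
  have hneg := hslope.eventually_lt_const (sub_neg.2 (hlt j τ hτpos heq hle))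
  obtain ⟨s, hs, hsτ⟩ := (hneg.and hmem).exists
  rw [slope_def_field] at hs
  refine hs.not_ge (div_nonneg_of_nonpos ?_ (sub_neg.2 hsτ.2).le)
  have := hbefore j s hsτ.1.le hsτ.2
  simp only [Pi.sub_apply]
  linarith

theorem softmaxPol_isPolicy {X A : Type*} [Fintype A] [Nonempty A] (θ : X → A → ℝ) :
    IsPolicy (softmaxPol θ) := by
  have hpos : ∀ x, 0 < ∑ a, Real.exp (θ x a) := fun x =>
    Finset.sum_pos (fun _ _ => Real.exp_pos _) Finset.univ_nonempty
  refine ⟨fun x a => div_nonneg (Real.exp_pos _).le (hpos x).le, fun x => ?_⟩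
  simp only [softmaxPol]
  rw [← Finset.sum_div, div_self (hpos x).ne']

theorem explorePol_isPolicy {X A : Type*} [Fintype A] [Nonempty A] {η : ℝ} (h0 : 0 ≤ η)
    (h1 : η ≤ 1) (θ : X → A → ℝ) : IsPolicy (explorePol η θ) := by
  obtain ⟨hs0, hs1⟩ := softmaxPol_isPolicy θ
  refine ⟨fun x a => add_nonneg (by positivity) (mul_nonneg (sub_nonneg.2 h1) (hs0 x a)),
    fun x => ?_⟩
  simp only [explorePol]
  rw [Finset.sum_add_distrib, ← Finset.mul_sum, hs1 x, Finset.sum_const, Finset.card_univ,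
    nsmul_eq_mul, mul_div_cancel₀ _ (Nat.cast_ne_zero.2 Fintype.card_ne_zero)]
  ring

theorem etaT_nonneg (t : ℝ) : 0 ≤ etaT t := by
  unfold etaT
  positivity

theorem etaT_lt_one {t : ℝ} (ht : 0 < t) : etaT t < 1 := by
  have := Real.log_pos (lt_add_of_pos_left 1 ht)
  exact inv_lt_one_of_one_lt₀ (lt_add_of_pos_right 1 (by positivity))

theorem abs_expected_next_value_le {X A : Type*} [Fintype X] [Fintype A]
    {q : X → ℝ} {g Q : X → A → ℝ} {m : ℝ} (hq0 : ∀ x, 0 ≤ q x) (hq1 : ∑ x, q x = 1)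
    (hg : IsPolicy g) (hQ : ∀ x a, |Q x a| ≤ m) :
    |∑ x, ∑ a, Q x a * g x a * q x| ≤ m := by
  calc |∑ x, ∑ a, Q x a * g x a * q x|
      ≤ ∑ x, ∑ a, |Q x a * g x a * q x| :=
        (Finset.abs_sum_le_sum_abs _ _).trans
          (Finset.sum_le_sum fun x _ => Finset.abs_sum_le_sum_abs _ _)
    _ ≤ ∑ x, ∑ a, m * g x a * q x := by
        refine Finset.sum_le_sum fun x _ => Finset.sum_le_sum fun a _ => ?_
        rw [abs_mul, abs_mul, abs_of_nonneg (hg.1 x a), abs_of_nonneg (hq0 x)]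
        exact mul_le_mul_of_nonneg_right (mul_le_mul_of_nonneg_right (hQ x a) (hg.1 x a)) (hq0 x)
    _ = m := by simp only [← Finset.sum_mul, ← Finset.mul_sum, hg.2, hq1, mul_one]

theorem limit_critic_uniform_bound
    {X A : Type*} [Fintype X] [Fintype A] [Nonempty X] [Nonempty A]
    [DecidableEq X] [DecidableEq A]
    (p : X → A → X → ℝ) (μ : X → ℝ) (r : X → A → ℝ) (γ α : ℝ)
    (hp0 : ∀ x a x', 0 ≤ p x a x') (hp1 : ∀ x a, ∑ x', p x a x' = 1)
    (hμ0 : ∀ x, 0 ≤ μ x) (hμ1 : ∑ x, μ x = 1)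
    (hr : ∀ x a, 0 ≤ r x a ∧ r x a ≤ 1) (hγ : 0 < γ ∧ γ < 1) (hα : 0 < α)
    (sigsta : (X → A → ℝ) → X × A → ℝ)
    (hsig : ∀ θ : X → A → ℝ,
      IsStationaryDist (actorKer γ p μ (softmaxPol θ)) (sigsta (softmaxPol θ)))
    (hsigLip : ∃ L : ℝ, ∀ f f' : X → A → ℝ,
      ∑ ξ : X × A, |sigsta f ξ - sigsta f' ξ| ≤ L * ∑ x, ∑ a, |f x a - f' x a|)
    (hergA : ∀ θ : X → A → ℝ, ∃ n, 0 < n ∧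
      ∀ ξ ξ' : X × A, 0 < kpow (actorKer γ p μ (softmaxPol θ)) n ξ ξ')
    (pista : (X → A → ℝ) → X × A → ℝ)
    (hpi : ∀ (η : ℝ) (θ : X → A → ℝ), 0 ≤ η → η < 1 →
      IsStationaryDist (criticKer p (explorePol η θ)) (pista (explorePol η θ)))
    (hpiLip : ∃ L : ℝ, ∀ f f' : X → A → ℝ,
      ∑ ξ : X × A, |pista f ξ - pista f' ξ| ≤ L * ∑ x, ∑ a, |f x a - f' x a|)
    (hergC : ∀ (η : ℝ) (θ : X → A → ℝ), 0 ≤ η → η < 1 → ∃ n, 0 < n ∧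
      ∀ ξ ξ' : X × A, 0 < kpow (criticKer p (explorePol η θ)) n ξ ξ')
    (Qb θb : ℝ → X → A → ℝ)
    (hQode : ∀ t, 0 ≤ t → ∀ x a, HasDerivAt (fun s => Qb s x a)
      (α * pista (explorePol (etaT t) (θb t)) (x, a) *
        (r x a + γ * (∑ z, ∑ a'', Qb t z a'' * explorePol (etaT t) (θb t) z a'' * p x a z)
          - Qb t x a)) t)
    (hθode : ∀ t, 0 ≤ t → ∀ x a, HasDerivAt (fun s => θb s x a)
      (zetaT t * sigsta (softmaxPol (θb t)) (x, a) *
        (Qb t x a - ∑ a', Qb t x a' * softmaxPol (θb t) x a')) t)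
    (hQb0 : ∀ x a, Qb 0 x a = 0) :
    ∀ t, 0 ≤ t → ∀ x a, |Qb t x a| ≤ 2 / (1 - γ) := by
  intro t ht x a
  have hγ' : 0 < 1 - γ := sub_pos.2 hγ.2
  set B : ℝ := 1 / (1 - γ) with hB
  have hBpos : 0 < B := by positivity
  have hBγ : (1 - γ) * B = 1 := mul_one_div_cancel hγ'.ne'
  set ε : ℝ := B / (1 + t) with hε
  have hεpos : 0 < ε := by positivity
  have hbt : B + ε * t ≤ 2 / (1 - γ) := by
    have h1 : ε * (1 + t) = B := div_mul_cancel₀ _ (by positivity)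
    have h2 : 2 / (1 - γ) = B + B := by rw [hB]; ring
    linarith
  have key := forall_lt_of_hasDerivAt_lt_barrier (ι := X × A)
    (u := fun i s => (Qb s i.1 i.2) ^ 2) (b := fun s => (B + ε * s) ^ 2)
    (fun i s hs => (hQode s hs i.1 i.2).pow 2)
    (fun s _ => (((hasDerivAt_id' s).const_mul ε).const_add B).pow 2)
    (fun i => by
      simpa [hQb0] using pow_pos hBpos 2) ?_ (x, a) t ht
  · exact (abs_lt_of_sq_lt_sq key (by positivity)).le.trans hbt
  rintro ⟨y, c⟩ s hs heq hle
  simp only at heq hle ⊢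
  set m := B + ε * s with hm
  have hmB : B ≤ m := le_add_of_nonneg_right (by positivity)
  have hm0 : 0 < m := hBpos.trans_le hmB
  have hQ : ∀ z a', |Qb s z a'| ≤ m := fun z a' => abs_le_of_sq_le_sq (hle (z, a')) hm0.le
  have hη1 := etaT_lt_one hs
  have hg := explorePol_isPolicy (etaT_nonneg s) hη1.le (θb s)
  have hE := abs_expected_next_value_le (hp0 y c) (hp1 y c) hg hQ
  have hπ := (hpi _ (θb s) (etaT_nonneg s) hη1).1 (y, c)
  set E := ∑ z, ∑ a'', Qb s z a'' * explorePol (etaT s) (θb s) z a'' * p y c z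
  have htarget : |r y c + γ * E| ≤ 1 + γ * m :=
    (abs_add_le _ _).trans (add_le_add (by rw [abs_of_nonneg (hr y c).1]; exact (hr y c).2)
      (by rw [abs_mul, abs_of_pos hγ.1]; exact mul_le_mul_of_nonneg_left hE hγ.1.le))
  have hprod : Qb s y c * (r y c + γ * E) ≤ m * (1 + γ * m) :=
    (le_abs_self _).trans (by
      rw [abs_mul]; exact mul_le_mul (hQ y c) htarget (abs_nonneg _) hm0.le)
  have hcontr : 1 ≤ (1 - γ) * m :=
    hBγ.symm.le.trans (mul_le_mul_of_nonneg_left hmB hγ'.le)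
  have hdrift : Qb s y c * (r y c + γ * E - Qb s y c) ≤ 0 := by
    nlinarith [mul_le_mul_of_nonneg_left hcontr hm0.le]
  have hnonpos := mul_nonpos_of_nonneg_of_nonpos (mul_nonneg hα.le hπ) hdrift
  have hbarrier := mul_pos hm0 hεpos
  norm_num
  nlinarith
end
end

section
/- ODE comparison estimate with logarithmic damping: let Y : [t₀,∞) → [0,∞) be a nonnegative differentiable function satisfying dY_t/dt ≤ −(C/log^{2n₀} t) Y_t + 1/t for all t ≥ t₀, where C > 0 is a constant, n₀ is a positive integer, and t₀ ≥ 2. Then Y_t = O(1/log⁴ t) as t → ∞, i.e. there exist constants K > 0 and t₁ ≥ t₀ such that Y_t ≤ K/log⁴ t for all t ≥ t₁. -/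
open MeasureTheory Filter Set
open scoped Classical

noncomputable section

theorem eventually_const_mul_log_pow_le (a C : ℝ) (hC : 0 < C) (m : ℕ) :
    ∀ᶠ t : ℝ in atTop, a * Real.log t ^ m ≤ C * t := by
  have h := ((Real.isLittleO_pow_log_id_atTop (n := m)).const_mul_left a).bound hC
  filter_upwards [h, eventually_ge_atTop 0] with t ht ht0
  simp only [Real.norm_eq_abs, id, abs_of_nonneg ht0] at ht
  exact (le_abs_self _).trans ht

theorem le_of_deriv_neg_at_level {f f' : ℝ → ℝ} {a K : ℝ}
    (hf : ∀ t, a ≤ t → HasDerivAt f (f' t) t) (ha : f a ≤ K)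
    (hneg : ∀ t, a ≤ t → f t = K → f' t < 0) : ∀ t, a ≤ t → f t ≤ K := fun t ht =>
  image_le_of_deriv_right_lt_deriv_boundary (f := f) (f' := f') (b := t) (B := fun _ => K)
    (B' := fun _ => 0) (fun x hx => (hf x hx.1).continuousAt.continuousWithinAt)
    (fun x hx => (hf x hx.1).hasDerivWithinAt) ha (fun x => hasDerivAt_const x K)
    (fun x hx => hneg x hx.1) ⟨ht, le_rfl⟩

/-- The logarithmic derivative of the weight `log t ^ 4` and the forcing term `1 / t` are both
dominated by the damping as soon as `8 * log t ^ (2 * n + 4) ≤ C * t`. -/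
theorem weighted_damping_neg {C L t y y' : ℝ} {n : ℕ} (hC : 0 < C) (ht : 0 < t) (hL : 1 ≤ L)
    (hbig : 8 * L ^ (2 * n + 4) ≤ C * t) (hlevel : 1 < L ^ 4 * y)
    (hy' : y' ≤ -(C / L ^ (2 * n)) * y + 1 / t) :
    4 * L ^ 3 * t⁻¹ * y + L ^ 4 * y' < 0 := by
  have hL0 : 0 < L := by linarith
  have hy : 0 < y := pos_of_mul_pos_right (by linarith : 0 < L ^ 4 * y) (by positivity)
  set D := C / L ^ (2 * n) with hD
  have hDpos : 0 < D := by positivity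
  have hforce : 8 * (L ^ 4 * t⁻¹) ≤ D := by
    rw [hD, le_div_iff₀ (by positivity), ← div_eq_mul_inv, mul_div_assoc', div_mul_eq_mul_div,
      div_le_iff₀ ht]
    calc 8 * L ^ 4 * L ^ (2 * n) = 8 * L ^ (2 * n + 4) := by ring
      _ ≤ C * t := hbig
  have hweight : L ^ 3 * t⁻¹ * y ≤ L ^ 4 * t⁻¹ * (L ^ 4 * y) := by
    have h34 : L ^ 3 ≤ L ^ 4 := pow_le_pow_right₀ hL (by norm_num)
    have hy4 : y ≤ L ^ 4 * y := le_mul_of_one_le_left hy.le (one_le_pow₀ hL)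
    gcongr
  have h1 : L ^ 4 * y' ≤ -D * (L ^ 4 * y) + L ^ 4 * t⁻¹ := by
    calc L ^ 4 * y' ≤ L ^ 4 * (-D * y + 1 / t) := by gcongr
      _ = _ := by ring
  have h2 := mul_le_mul_of_nonneg_right hforce (by linarith : 0 ≤ L ^ 4 * y)
  have h3 : D < D * (L ^ 4 * y) := lt_mul_of_one_lt_right hDpos hlevel
  linarith

theorem ode_comparison_log_damping
    (Y Y' : ℝ → ℝ) (C : ℝ) (n₀ : ℕ) (t₀ : ℝ)
    (hC : 0 < C) (hn₀ : 1 ≤ n₀) (ht₀ : 2 ≤ t₀)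
    (hYnonneg : ∀ t, t₀ ≤ t → 0 ≤ Y t)
    (hYderiv : ∀ t, t₀ ≤ t → HasDerivAt Y (Y' t) t)
    (hYineq : ∀ t, t₀ ≤ t →
      Y' t ≤ -(C / Real.log t ^ (2 * n₀)) * Y t + 1 / t) :
    ∃ K : ℝ, 0 < K ∧ ∃ t₁ : ℝ, t₀ ≤ t₁ ∧ ∀ t, t₁ ≤ t → Y t ≤ K / Real.log t ^ 4 := by
  obtain ⟨s, hs⟩ := eventually_atTop.mp
    (eventually_const_mul_log_pow_le 8 C hC (2 * n₀ + 4))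
  set t₁ := max t₀ (max s (Real.exp 1))
  have ht₀₁ : t₀ ≤ t₁ := le_max_left _ _
  have hst₁ : s ≤ t₁ := (le_max_left _ _).trans (le_max_right _ _)
  have het₁ : Real.exp 1 ≤ t₁ := (le_max_right _ _).trans (le_max_right _ _)
  have hpos : ∀ t, t₁ ≤ t → 0 < t := fun t ht => by linarith
  have hlog : ∀ t, t₁ ≤ t → 1 ≤ Real.log t := fun t ht =>
    (Real.le_log_iff_exp_le (hpos t ht)).mpr (het₁.trans ht)
  set K := max (Real.log t₁ ^ 4 * Y t₁) 2
  have hK : 2 ≤ K := le_max_right _ _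
  refine ⟨K, by linarith, t₁, ht₀₁, fun t ht => ?_⟩
  rw [le_div_iff₀ (pow_pos (by linarith [hlog t ht]) 4), mul_comm]
  refine le_of_deriv_neg_at_level (f := fun t => Real.log t ^ 4 * Y t)
    (f' := fun t => 4 * Real.log t ^ 3 * t⁻¹ * Y t + Real.log t ^ 4 * Y' t)
    (fun u hu => ?_) (le_max_left _ _) (fun u hu huK => ?_) t ht
  · exact (((Real.hasDerivAt_log (hpos u hu).ne').pow 4).mul (hYderiv u (ht₀₁.trans hu))).congr_deriv
      (by norm_num)
  · have hlevel : 1 < Real.log u ^ 4 * Y u := by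
      linarith
    exact weighted_damping_neg hC (hpos u hu) (hlog u hu) (hs u (hst₁.trans hu)) hlevel
      (hYineq u (ht₀₁.trans hu))
end
end
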